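/- arXiv:math/0406538 — 9 statements merged into one kernel-verified Lean document; each statement's English description precedes it below -/
import Mathlib

section
/- Let n be an odd positive integer and let S be a set of integers with S ⊆ {i : i odd, 0 < i < n/3} ∪ {i : i ≡ n (mod 4), 0 < i < n}. Let f(x) = x^n + Σ_{i∈S} x^i + 1 in F_2[x]. If n ≡ 1 or n ≡ -1 (mod 8), then f has an odd number of irreducible factors (counted with multiplicity) in F_2[x]; if n ≡ 3 or n ≡ -3 (mod 8), then f has an even number of irreducible factors in F_2[x]. -/
open Polynomial

/-- The sum of `t a b` over all pairs of entries `a`, `b` of a list, `a` standing before `b`. -/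
def List.pairSum {α M : Type*} [AddCommMonoid M] (t : α → α → M) : List α → M
  | [] => 0
  | a :: l => (l.map (t a)).sum + l.pairSum t

section PairSum

variable {α M : Type*} [AddCommMonoid M]

lemma List.pairSum_append (t : α → α → M) (l₁ l₂ : List α) :
    (l₁ ++ l₂).pairSum t =
      l₁.pairSum t + l₂.pairSum t + (l₁.map fun a => (l₂.map (t a)).sum).sum := by
  induction l₁ with
  | nil => simp [pairSum]
  | cons a l ih =>
    simp only [cons_append, pairSum, map_append, sum_append, ih, map_cons, sum_cons]
    abel

lemma List.Perm.pairSum_eq {t : α → α → M} (ht : ∀ a b, t a b = t b a) {l₁ l₂ : List α}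
    (h : l₁.Perm l₂) : l₁.pairSum t = l₂.pairSum t := by
  induction h with
  | nil => rfl
  | cons a h ih => simp only [List.pairSum, ih, (h.map (t a)).sum_eq]
  | swap a b l =>
    simp only [List.pairSum, List.map_cons, List.sum_cons, ht a b]
    abel
  | trans _ _ ih₁ ih₂ => exact ih₁.trans ih₂

lemma List.pairSum_ofFn (t : α → α → M) {n : ℕ} (v : Fin n → α) :
    (List.ofFn v).pairSum t = ∑ i, ∑ j ∈ Finset.Ioi i, t (v i) (v j) := by
  induction n with
  | zero => simp [pairSum]
  | succ n ih =>
    rw [List.ofFn_succ, pairSum, ih, Fin.sum_univ_succ, Fin.sum_Ioi_zero]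
    simp [Fin.sum_Ioi_succ, List.sum_ofFn, Function.comp_def]

end PairSum

lemma monic_of_ne_zero {p : (ZMod 2)[X]} (hp : p ≠ 0) : p.Monic := by
  have h0 := leadingCoeff_ne_zero.mpr hp
  rw [Monic]
  generalize p.leadingCoeff = c at h0
  revert c
  decide

section CharTwo

variable {k : Type*} [Field k] [CharP k 2]

lemma div_add_sq_eq {a b : k} (h : a ≠ b) :
    a * b / (a + b) ^ 2 = (a / (a + b)) ^ 2 + a / (a + b) := by
  have hab : a + b ≠ 0 := fun h0 => h (CharTwo.add_eq_zero.mp h0)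
  field_simp
  linear_combination (-a ^ 2) * CharTwo.two_eq_zero (R := k)

lemma sq_div_add (a b : k) : (a / (a + b)) ^ 2 = a ^ 2 / (a ^ 2 + b ^ 2) := by
  rw [div_pow, CharTwo.add_sq]

lemma list_sum_sq (l : List k) : l.sum ^ 2 = (l.map (· ^ 2)).sum := by
  induction l with
  | nil => simp
  | cons a l ih => simp [CharTwo.add_sq, ih]

lemma pairSum_sq {α : Type*} (t : α → α → k) (l : List α) :
    (l.pairSum t) ^ 2 = l.pairSum fun a b => t a b ^ 2 := by
  induction l with
  | nil => simp [List.pairSum]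
  | cons a l ih =>
    simp only [List.pairSum, CharTwo.add_sq, ih, list_sum_sq, List.map_map, Function.comp_def]

lemma pairSum_map {α β M : Type*} [AddCommMonoid M] (t : β → β → M) (g : α → β) (l : List α) :
    (l.map g).pairSum t = l.pairSum fun a b => t (g a) (g b) := by
  induction l with
  | nil => simp [List.pairSum]
  | cons a l ih => simp [List.pairSum, ih, Function.comp_def]

lemma pairSum_eq_of_nodup {l : List k} (hl : l.Nodup) :
    l.pairSum (fun a b => a * b / (a + b) ^ 2) =
      (l.pairSum fun a b => a / (a + b)) ^ 2 + l.pairSum fun a b => a / (a + b) := by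
  induction l with
  | nil => simp [List.pairSum]
  | cons a l ih =>
    have hmap : (l.map fun b => a * b / (a + b) ^ 2).sum =
        (l.map fun b => (a / (a + b)) ^ 2).sum + (l.map fun b => a / (a + b)).sum := by
      rw [← List.sum_map_add]
      refine congrArg List.sum (List.map_congr_left fun b hb => div_add_sq_eq ?_)
      rintro rfl
      exact (List.nodup_cons.mp hl).1 hb
    rw [List.pairSum, hmap, ih (List.nodup_cons.mp hl).2, List.pairSum,
      CharTwo.add_sq (List.sum _), list_sum_sq (List.map _ _), List.map_map]
    simp only [Function.comp_def]
    ring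

/-- A list whose squaring is a rotation of it contributes its length minus one. -/
lemma pairSum_of_rotation {a : k} {l : List k} (hl : (a :: l).Nodup)
    (hrot : (a :: l).map (· ^ 2) = l ++ [a]) :
    (a :: l).pairSum (fun a b => a * b / (a + b) ^ 2) = (l.length : k) := by
  have hsq : ((a :: l).pairSum fun a b => a / (a + b)) ^ 2 =
      (l ++ [a]).pairSum fun a b => a / (a + b) := by
    rw [pairSum_sq, ← hrot, pairSum_map]
    simp only [sq_div_add]
  have hone : (l.map fun b => b / (b + a)).sum + (l.map fun b => a / (a + b)).sum = l.length := by
    rw [← List.sum_map_add, List.map_congr_left (g := fun _ => (1 : k))]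
    · simp
    · intro b hb
      have hab : a + b ≠ 0 := fun h0 => (List.nodup_cons.mp hl).1 <| by
        rwa [CharTwo.add_eq_zero.mp h0]
      rw [add_comm b a, ← add_div, add_comm b a, div_self hab]
  rw [pairSum_eq_of_nodup hl, hsq, List.pairSum_append, ← hone]
  simp only [List.pairSum, List.map_cons, List.map_nil, List.sum_cons, List.sum_nil, add_zero]
  linear_combination CharTwo.add_self_eq_zero (l.pairSum fun a b => a / (a + b))

lemma cross_sum_eq_zero {l₁ l₂ : List k} (hd : l₁.Disjoint l₂)
    (h₁ : (l₁.map (· ^ 2)).Perm l₁) (h₂ : (l₂.map (· ^ 2)).Perm l₂) :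
    (l₁.map fun a => (l₂.map fun b => a * b / (a + b) ^ 2).sum).sum = 0 := by
  have hsplit : (l₁.map fun a => (l₂.map fun b => a * b / (a + b) ^ 2).sum).sum =
      (l₁.map fun a => (l₂.map fun b => a / (a + b)).sum).sum ^ 2 +
        (l₁.map fun a => (l₂.map fun b => a / (a + b)).sum).sum := by
    simp only [list_sum_sq, List.map_map, Function.comp_def]
    rw [← List.sum_map_add]
    refine congrArg List.sum (List.map_congr_left fun a ha => ?_)
    rw [← List.sum_map_add]
    refine congrArg List.sum (List.map_congr_left fun b hb => div_add_sq_eq ?_)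
    rintro rfl
    exact hd ha hb
  have hfix : (l₁.map fun a => (l₂.map fun b => a / (a + b)).sum).sum ^ 2 =
      (l₁.map fun a => (l₂.map fun b => a / (a + b)).sum).sum := by
    simp only [list_sum_sq, List.map_map, Function.comp_def, sq_div_add]
    rw [← (h₁.map fun a => (l₂.map fun b => a / (a + b)).sum).sum_eq, List.map_map]
    refine congrArg List.sum (List.map_congr_left fun a _ => ?_)
    simp only [Function.comp_def]
    rw [← (h₂.map fun b => a ^ 2 / (a ^ 2 + b)).sum_eq, List.map_map]
    simp only [Function.comp_def]
  rw [hsplit, hfix, CharTwo.add_self_eq_zero]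

variable [Algebra (ZMod 2) k]

lemma map_sq_roots_perm {p : (ZMod 2)[X]} {l : List k}
    (hl : p.map (algebraMap (ZMod 2) k) = (l.map fun a => X - C a).prod) :
    (l.map (· ^ 2)).Perm l := by
  have h := congrArg (Polynomial.map (frobenius k 2)) hl
  rw [Polynomial.map_map, Subsingleton.elim ((frobenius k 2).comp _) (algebraMap (ZMod 2) k), hl,
    Polynomial.map_list_prod, List.map_map] at h
  have h' := congrArg roots h
  have e : (Polynomial.map (frobenius k 2) ∘ fun a : k => X - C a) =
      (fun a => X - C a) ∘ (· ^ 2) := by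
    ext1 a
    simp [frobenius_def]
  rw [e, ← List.map_map, ← Multiset.prod_coe, ← Multiset.prod_coe, ← Multiset.map_coe,
    ← Multiset.map_coe (fun a : k => X - C a), roots_multiset_prod_X_sub_C,
    roots_multiset_prod_X_sub_C] at h'
  exact (Multiset.coe_eq_coe.mp h').symm

lemma pairSum_roots_of_irreducible {p : (ZMod 2)[X]} (hp : Irreducible p) {l : List k}
    (hl : p.map (algebraMap (ZMod 2) k) = (l.map fun a => X - C a).prod) :
    l.pairSum (fun a b => a * b / (a + b) ^ 2) = (p.natDegree : k) + 1 := by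
  have hlen : l.length = p.natDegree := by
    rw [← natDegree_map (algebraMap (ZMod 2) k), hl, ← Multiset.prod_coe, ← Multiset.map_coe,
      natDegree_multiset_prod_X_sub_C_eq_card, Multiset.coe_card]
  have hpos : 0 < p.natDegree := hp.natDegree_pos
  obtain ⟨a, ha⟩ := List.exists_mem_of_length_pos (hlen ▸ hpos)
  have hroot : aeval a p = 0 := by
    rw [aeval_def, ← eval_map, hl, eval_list_prod]
    exact List.prod_eq_zero (List.mem_map.mpr ⟨X - C a, List.mem_map_of_mem ha, by simp⟩)
  have hdvd (q : (ZMod 2)[X]) (hq : aeval a q = 0) : p ∣ q := by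
    have := minpoly.dvd (ZMod 2) a hq
    rw [← minpoly.eq_of_irreducible hp hroot] at this
    exact dvd_of_mul_right_dvd this
  have hper (m : ℕ) : a ^ 2 ^ m = a ↔ p.natDegree ∣ m := by
    have hcard := hp.natDegree_dvd_iff_dvd_X_pow_card_pow_sub_X (n := m)
    rw [hcard, Nat.card_zmod]
    constructor
    · intro h
      exact hdvd _ (by simp [h])
    · rintro ⟨q, hq⟩
      simpa [hroot, sub_eq_zero] using congrArg (aeval a) hq
  have hmem (i : ℕ) : a ^ 2 ^ i ∈ l := by
    induction i with
    | zero => simpa using ha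
    | succ i ih =>
      rw [pow_succ, pow_mul]
      exact (map_sq_roots_perm hl).subset (List.mem_map_of_mem (f := (· ^ 2)) ih)
  have hinj {i j : ℕ} (hij : i < j) (hj : j < p.natDegree) : a ^ 2 ^ i ≠ a ^ 2 ^ j := by
    intro h
    have : a ^ 2 ^ (j - i) = a := by
      apply iterateFrobenius_inj k 2 i
      simp only [iterateFrobenius_def]
      rw [h, ← pow_mul, ← pow_add, Nat.sub_add_cancel hij.le]
    exact absurd (Nat.le_of_dvd (by omega) ((hper _).mp this)) (by omega)
  obtain ⟨d, hd⟩ : ∃ d, p.natDegree = d + 1 := ⟨_, (Nat.succ_pred_eq_of_pos hpos).symm⟩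
  have hndc : ((List.range (d + 1)).map fun i => a ^ 2 ^ i).Nodup := by
    refine List.Nodup.map_on (fun i hi j hj h => ?_) List.nodup_range
    rw [List.mem_range] at hi hj
    by_contra hne
    rcases Nat.lt_or_gt_of_ne hne with hlt | hlt
    · exact hinj hlt (by omega) h
    · exact hinj hlt (by omega) h.symm
  have hperm : ((List.range (d + 1)).map fun i => a ^ 2 ^ i).Perm l := by
    refine (List.subperm_of_subset hndc ?_).perm_of_length_le (by simp [hlen, hd])
    intro b hb
    obtain ⟨i, -, rfl⟩ := List.mem_map.mp hb
    exact hmem i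
  rw [← hperm.pairSum_eq (fun a b => by rw [mul_comm, add_comm])]
  have hcons : ((List.range (d + 1)).map fun i => a ^ 2 ^ i) =
      a :: (List.range d).map fun i => a ^ 2 ^ (i + 1) := by
    rw [List.range_succ_eq_map]
    simp [Function.comp_def]
  have hrot : ((List.range (d + 1)).map fun i => a ^ 2 ^ i).map (· ^ 2) =
      ((List.range d).map fun i => a ^ 2 ^ (i + 1)) ++ [a] := by
    rw [List.range_succ, List.map_append, List.map_append, List.map_map]
    simp only [Function.comp_def, ← pow_mul, ← pow_succ, List.map_cons, List.map_nil]
    rw [(hper (d + 1)).mpr (dvd_of_eq hd)]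
  rw [hcons] at hrot hndc ⊢
  rw [pairSum_of_rotation hndc hrot, hd]
  simp only [List.length_map, List.length_range]
  push_cast
  linear_combination -CharTwo.two_eq_zero (R := k)

/-- The number of irreducible factors of a squarefree polynomial over `𝔽₂` with given roots. -/
lemma pairSum_roots_eq (s : Multiset (ZMod 2)[X]) (hs : ∀ p ∈ s, Irreducible p) (l : List k)
    (hnd : l.Nodup)
    (hl : s.prod.map (algebraMap (ZMod 2) k) = (l.map fun a => X - C a).prod) :
    l.pairSum (fun a b => a * b / (a + b) ^ 2) = (s.prod.natDegree : k) + s.card := by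
  induction s using Multiset.induction_on generalizing l with
  | empty =>
    have h := congrArg natDegree hl
    rw [← Multiset.prod_coe, ← Multiset.map_coe,
      natDegree_multiset_prod_X_sub_C_eq_card, Multiset.coe_card] at h
    have : l = [] := List.length_eq_zero_iff.mp (by simpa using h.symm)
    simp [this, List.pairSum]
  | cons p s ih =>
    have hp := hs p (Multiset.mem_cons_self p s)
    have hs' := fun q hq => hs q (Multiset.mem_cons_of_mem hq)
    rw [Multiset.prod_cons] at hl ⊢
    have hs0 : s.prod ≠ 0 := Multiset.prod_ne_zero fun h0 => (hs' 0 h0).ne_zero rfl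
    have hsplit : ((p * s.prod).map (algebraMap (ZMod 2) k)).Splits := by
      rw [hl]
      refine Splits.listProd fun f hf => ?_
      obtain ⟨a, -, rfl⟩ := List.mem_map.mp hf
      exact Splits.X_sub_C a
    have h0 : (p * s.prod).map (algebraMap (ZMod 2) k) ≠ 0 :=
      ((monic_of_ne_zero (mul_ne_zero hp.ne_zero hs0)).map _).ne_zero
    have hlist {q : (ZMod 2)[X]} (hq : q ≠ 0) (hdvd : q ∣ p * s.prod) :
        q.map (algebraMap (ZMod 2) k) =
          ((q.map (algebraMap (ZMod 2) k)).roots.toList.map fun a => X - C a).prod := by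
      rw [← Multiset.prod_coe, ← Multiset.map_coe, Multiset.coe_toList]
      exact (hsplit.of_dvd h0 (Polynomial.map_dvd _ hdvd)).eq_prod_roots_of_monic
        ((monic_of_ne_zero hq).map _)
    have hlp := hlist hp.ne_zero (dvd_mul_right _ _)
    have hls := hlist hs0 (dvd_mul_left _ _)
    set lp := (p.map (algebraMap (ZMod 2) k)).roots.toList
    set ls := (s.prod.map (algebraMap (ZMod 2) k)).roots.toList
    have hperm : l.Perm (lp ++ ls) := by
      rw [Polynomial.map_mul, hlp, hls, ← List.prod_append, ← List.map_append] at hl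
      have h := congrArg roots hl
      rw [← Multiset.prod_coe, ← Multiset.prod_coe, ← Multiset.map_coe, ← Multiset.map_coe,
        roots_multiset_prod_X_sub_C, roots_multiset_prod_X_sub_C] at h
      exact (Multiset.coe_eq_coe.mp h).symm
    have hnd' := hperm.nodup_iff.mp hnd
    rw [List.nodup_append'] at hnd'
    rw [hperm.pairSum_eq (fun a b => by rw [mul_comm, add_comm]), List.pairSum_append,
      cross_sum_eq_zero hnd'.2.2 (map_sq_roots_perm hlp) (map_sq_roots_perm hls),
      pairSum_roots_of_irreducible hp hlp, ih hs' ls hnd'.2.1 hls,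
      natDegree_mul hp.ne_zero hs0, Multiset.card_cons]
    push_cast
    ring

end CharTwo

section PowerSums

variable {R : Type*} [CommRing R] {n : ℕ}

/-- Newton's identities, in terms of the coefficients of `∏ (X - αᵢ)`. -/
lemma sum_pow_eq_coeff (α : Fin n → R) {k : ℕ} (hk : 0 < k) (hkn : k ≤ n) :
    ∑ i, α i ^ k = -(k * (∏ i, (X - C (α i))).coeff (n - k)) -
      ∑ a ∈ Finset.HasAntidiagonal.antidiagonal k with a.1 ∈ Set.Ioo 0 k,
        (∏ i, (X - C (α i))).coeff (n - a.1) * ∑ i, α i ^ a.2 := by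
  have hcoeff {j : ℕ} (hj : j ≤ n) : (∏ i, (X - C (α i))).coeff (n - j) =
      (-1) ^ j * MvPolynomial.aeval α (MvPolynomial.esymm (Fin n) R j) := by
    have h := Multiset.prod_X_sub_C_coeff (Finset.univ.val.map α) (k := n - j) (by simp)
    rw [Multiset.map_map] at h
    rw [MvPolynomial.aeval_esymm_eq_multiset_esymm, Finset.prod_eq_multiset_prod]
    convert h using 3 <;> simp <;> omega
  have h := congrArg (MvPolynomial.aeval α) (MvPolynomial.psum_eq_mul_esymm_sub_sum (Fin n) R k hk)
  simp only [map_sub, map_sum, map_mul, map_pow, map_neg, map_one, map_natCast,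
    MvPolynomial.psum, MvPolynomial.aeval_X] at h
  rw [h, hcoeff hkn]
  congr 1
  · ring
  · refine Finset.sum_congr rfl fun a ha => ?_
    have : a.1 < k := (Finset.mem_filter.mp ha).2.2
    rw [hcoeff (by omega)]

lemma sum_pow_eq_zero (α : Fin n → R) (Q : ℕ → Prop)
    (hQ : ∀ k, Q k → 0 < k ∧ k ≤ n ∧ (∏ i, (X - C (α i))).coeff (n - k) = 0)
    (hstep : ∀ k j, Q k → 0 < j → j < k → (∏ i, (X - C (α i))).coeff (n - j) ≠ 0 → Q (k - j))
    {k : ℕ} (hk : Q k) : ∑ i, α i ^ k = 0 := by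
  induction k using Nat.strong_induction_on with
  | _ k ih =>
    obtain ⟨hpos, hle, h0⟩ := hQ k hk
    rw [sum_pow_eq_coeff α hpos hle, h0, Finset.sum_eq_zero]
    · simp
    rintro ⟨j, m⟩ hjm
    simp only [Finset.mem_filter, Finset.HasAntidiagonal.mem_antidiagonal, Set.mem_Ioo] at hjm
    obtain ⟨hsum, hj, hjk⟩ := hjm
    by_cases hc : (∏ i, (X - C (α i))).coeff (n - j) = 0
    · simp [hc]
    · obtain rfl : m = k - j := by omega
      rw [ih (k - j) (by omega) (hstep k j hk hj hjk hc), mul_zero]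

end PowerSums

section Congruences

variable {R ι : Type*} [CommRing R]

lemma prod_add_two_mul_modEq (s : Finset ι) (h : ι → R) {u : R} (hu : 8 ∣ u ^ 2 - 1) :
    ∃ e, (∑ i ∈ s, h i) ^ 2 = ∑ i ∈ s, h i ^ 2 + 2 * e ∧
      8 ∣ ∏ i ∈ s, (u + 2 * h i) - u ^ s.card * (1 + 2 * u * ∑ i ∈ s, h i + 4 * e) := by
  classical
  obtain ⟨v, hv⟩ := hu
  induction s using Finset.induction_on with
  | empty => exact ⟨0, by simp⟩
  | insert a s ha ih =>
    obtain ⟨e, he, w, hw⟩ := ih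
    refine ⟨e + h a * ∑ i ∈ s, h i, ?_, ?_⟩
    · rw [Finset.sum_insert ha, Finset.sum_insert ha]
      linear_combination he
    · rw [Finset.prod_insert ha, Finset.sum_insert ha, Finset.card_insert_of_notMem ha]
      refine ⟨(u + 2 * h a) * w + u ^ s.card * (h a * e - 2 * h a * v), ?_⟩
      linear_combination (u + 2 * h a) * hw - 2 * u ^ s.card * h a * hv

lemma prod_one_sub_four_mul_modEq (s : Finset ι) (t : ι → R) :
    8 ∣ ∏ i ∈ s, (1 - 4 * t i) - (1 - 4 * ∑ i ∈ s, t i) := by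
  classical
  induction s using Finset.induction_on with
  | empty => simp
  | insert a s ha ih =>
    obtain ⟨w, hw⟩ := ih
    rw [Finset.prod_insert ha, Finset.sum_insert ha]
    refine ⟨(1 - 4 * t a) * w + 2 * t a * ∑ i ∈ s, t i, ?_⟩
    linear_combination (1 - 4 * t a) * hw

lemma Odd.eight_dvd_sq_sub_one {n : ℕ} (hn : Odd n) : (8 : ℤ) ∣ (n : ℤ) ^ 2 - 1 :=
  Int.eight_dvd_sq_sub_one_of_odd (by exact_mod_cast hn)

lemma Odd.eight_dvd_pow_self_sub {n : ℕ} (hn : Odd n) : (8 : ℤ) ∣ (n : ℤ) ^ n - n := by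
  obtain ⟨m, hm⟩ := hn
  have h : (8 : ℤ) ∣ ((n : ℤ) ^ 2) ^ m - 1 ^ m :=
    (Odd.eight_dvd_sq_sub_one ⟨m, hm⟩).trans (sub_dvd_pow_sub_pow _ _ m)
  have e : (n : ℤ) ^ n - n = n * (((n : ℤ) ^ 2) ^ m - 1 ^ m) := by
    conv_lhs => rw [show (n : ℤ) ^ n = (n : ℤ) ^ (2 * m + 1) by rw [← hm]]
    ring
  exact e ▸ h.mul_left _

end Congruences

section Discriminant

variable {R : Type*} [CommRing R] [IsDomain R] [CharZero R] {n : ℕ} {S : Finset ℕ} {α : Fin n → R}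

omit [IsDomain R] [CharZero R] in
lemma prod_roots_eq (hn : Odd n) (hS : ∀ i ∈ S, Odd i)
    (hα : X ^ n + ∑ i ∈ S, X ^ i + 1 = ∏ i, (X - C (α i))) : ∏ i, α i = -1 := by
  have h := congrArg (eval 0) hα
  rw [eval_prod] at h
  simp only [eval_add, eval_pow, eval_X, eval_finsetSum, eval_one, eval_sub, eval_C, zero_sub,
    Finset.prod_neg, Finset.card_univ, Fintype.card_fin, hn.neg_one_pow] at h
  rw [zero_pow hn.pos.ne', Finset.sum_eq_zero fun i hi => zero_pow (hS i hi).pos.ne'] at h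
  linear_combination h

omit [IsDomain R] [CharZero R] in
lemma root_pow_eq (hα : X ^ n + ∑ i ∈ S, X ^ i + 1 = ∏ i, (X - C (α i))) (i : Fin n) :
    α i ^ n + ∑ s ∈ S, α i ^ s + 1 = 0 := by
  have h := congrArg (eval (α i)) hα
  rw [eval_prod, Finset.prod_eq_zero (Finset.mem_univ i) (by simp)] at h
  simpa [eval_finsetSum] using h

lemma root_mul_prod_add_eq (hn : Odd n) (hS : ∀ i ∈ S, Odd i)
    (hα : X ^ n + ∑ i ∈ S, X ^ i + 1 = ∏ i, (X - C (α i))) (i : Fin n) :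
    α i * ∏ j ∈ {i}ᶜ, (α i + α j) = -1 := by
  have h := congrArg (eval (-α i)) hα
  rw [eval_prod, Finset.prod_congr rfl (g := fun j => -(α i + α j)) (by intros; simp; ring)] at h
  simp only [eval_add, eval_pow, eval_X, eval_finsetSum, eval_one,
    Finset.prod_neg, Finset.card_univ, Fintype.card_fin, hn.neg_one_pow, hn.neg_pow] at h
  rw [Finset.sum_congr rfl fun s hs => (hS s hs).neg_pow (α i), Finset.sum_neg_distrib,
    ← Finset.prod_mul_prod_compl {i}, Finset.prod_singleton] at h
  have h0 := root_pow_eq hα i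
  refine mul_left_cancel₀ (two_ne_zero (α := R)) ?_
  linear_combination h + h0

lemma isUnit_root_add_root (hn : Odd n) (hS : ∀ i ∈ S, Odd i)
    (hα : X ^ n + ∑ i ∈ S, X ^ i + 1 = ∏ i, (X - C (α i))) {i j : Fin n} (hij : i ≠ j) :
    IsUnit (α i + α j) := by
  have h := root_mul_prod_add_eq hn hS hα i
  refine isUnit_of_dvd_unit ?_ (isUnit_one (M := R)).neg
  rw [← h]
  exact (Finset.dvd_prod_of_mem (fun j => α i + α j) (by simpa using hij.symm)).mul_left _

lemma prod_prod_add_sq_eq_one (hn : Odd n) (hS : ∀ i ∈ S, Odd i)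
    (hα : X ^ n + ∑ i ∈ S, X ^ i + 1 = ∏ i, (X - C (α i))) :
    ∏ i, ∏ j ∈ Finset.Ioi i, (α i + α j) ^ 2 = 1 := by
  have h : ∏ i, (α i * ∏ j ∈ {i}ᶜ, (α i + α j)) = ∏ _i : Fin n, (-1 : R) :=
    Finset.prod_congr rfl fun i _ => root_mul_prod_add_eq hn hS hα i
  rw [Finset.prod_mul_distrib, prod_roots_eq hn hS hα, Finset.prod_const, Finset.card_univ,
    Fintype.card_fin, hn.neg_one_pow,
    ← Finset.prod_prod_Ioi_mul_eq_prod_prod_off_diag fun j i => α i + α j] at h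
  rw [Finset.prod_congr rfl fun i _ => Finset.prod_congr rfl
    (g := fun j => (α i + α j) * (α j + α i)) (by intros; ring)]
  linear_combination -h

omit [IsDomain R] [CharZero R] in
/-- `αᵢ f'(αᵢ)`, reduced with the help of `f(αᵢ) = 0`. -/
lemma root_mul_prod_sub_eq (hn : Odd n) (hS : ∀ i ∈ S, Odd i)
    (hα : X ^ n + ∑ i ∈ S, X ^ i + 1 = ∏ i, (X - C (α i))) (i : Fin n) :
    α i * ∏ j ∈ {i}ᶜ, (α i - α j) =
      -n + 2 * ∑ s ∈ S, ((((s : ℤ) - n) / 2 : ℤ) : R) * α i ^ s := by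
  have hder := congrArg (fun p => eval (α i) (derivative p)) hα
  simp only [derivative_prod_finset, eval_finsetSum, derivative_add, derivative_sum, derivative_X_pow,
    derivative_one, add_zero, eval_add, eval_mul, eval_pow, eval_X, eval_C, eval_prod, eval_sub,
    derivative_sub, derivative_X, derivative_C, sub_zero, mul_one] at hder
  rw [Finset.sum_eq_single i] at hder
  rotate_left
  · intro b _ hb
    exact Finset.prod_eq_zero (Finset.mem_erase.mpr ⟨hb.symm, Finset.mem_univ i⟩) (sub_self _)
  · simp
  have herase : Finset.univ.erase i = {i}ᶜ := by ext; simp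
  rw [herase] at hder
  rw [← hder, mul_add, Finset.mul_sum, Finset.mul_sum]
  have hterm : ∀ s ∈ S, 2 * (((((s : ℤ) - n) / 2 : ℤ) : R) * α i ^ s) =
      α i * (s * α i ^ (s - 1)) - n * α i ^ s := by
    intro s hs
    have h2 : (2 : ℤ) ∣ s - n := by
      obtain ⟨a, ha⟩ := hS s hs
      obtain ⟨b, hb⟩ := hn
      omega
    have h2R : (2 : R) * ((((s : ℤ) - n) / 2 : ℤ) : R) = s - n := by
      exact_mod_cast congrArg (Int.cast (R := R)) (Int.mul_ediv_cancel' h2)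
    have hp : α i ^ s = α i * α i ^ (s - 1) := by
      rw [← pow_succ', Nat.sub_add_cancel (hS s hs).pos]
    rw [← mul_assoc, h2R, sub_mul]
    conv_lhs => enter [1]; rw [hp]
    ring
  rw [Finset.sum_congr rfl hterm, Finset.sum_sub_distrib, ← Finset.mul_sum,
    ← Finset.mul_sum]
  have hp : α i ^ n = α i * α i ^ (n - 1) := by
    rw [← pow_succ', Nat.sub_add_cancel hn.pos]
  have h0 := root_pow_eq hα i
  linear_combination (n : R) * h0 - (n : R) * hp

omit [IsDomain R] [CharZero R] in
lemma sub_mem_of_coeff_ne_zero (hα : X ^ n + ∑ i ∈ S, X ^ i + 1 = ∏ i, (X - C (α i))) {j : ℕ}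
    (hj : 0 < j) (hjn : j < n) (h : (∏ i, (X - C (α i))).coeff (n - j) ≠ 0) : n - j ∈ S := by
  by_contra hmem
  refine h ?_
  rw [← hα]
  simp only [coeff_add, coeff_X_pow, finsetSum_coeff, coeff_one, Finset.sum_ite_eq, if_neg hmem]
  rw [if_neg (by omega), if_neg (by omega)]
  simp

variable (hS : ∀ i ∈ S, (Odd i ∧ 0 < i ∧ 3 * i < n) ∨ (i % 4 = n % 4 ∧ 0 < i ∧ i < n))
include hS

omit [IsDomain R] [CharZero R] in
lemma sum_odd_pow_eq_zero (hn : Odd n)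
    (hα : X ^ n + ∑ i ∈ S, X ^ i + 1 = ∏ i, (X - C (α i))) {k : ℕ} (hk : Odd k) (hkn : k < n) :
    ∑ i, α i ^ k = 0 := by
  rw [Nat.odd_iff] at hn
  have key {j : ℕ} (hj : 0 < j) (hjn : j < n)
      (h : (∏ i, (X - C (α i))).coeff (n - j) ≠ 0) : j % 2 = 0 := by
    rcases hS _ (sub_mem_of_coeff_ne_zero hα hj hjn h) with ⟨h1, -, -⟩ | ⟨h1, -, -⟩
    · rw [Nat.odd_iff] at h1
      omega
    · omega
  refine sum_pow_eq_zero α (fun k => k % 2 = 1 ∧ k < n) (fun k hk => ?_)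
    (fun k j hk hj hjk hc => ?_) ⟨Nat.odd_iff.mp hk, hkn⟩
  · refine ⟨by omega, by omega, ?_⟩
    by_contra hc
    have := key (by omega) hk.2 hc
    omega
  · have := key hj (by omega) hc
    omega

omit [IsDomain R] [CharZero R] in
lemma sum_pow_eq_zero_of_mod_four (hα : X ^ n + ∑ i ∈ S, X ^ i + 1 = ∏ i, (X - C (α i))) {k : ℕ}
    (hk : k % 4 = 2) (hkn : 3 * k < 2 * n) : ∑ i, α i ^ k = 0 := by
  have key {j : ℕ} (hj : 0 < j) (hjn : 3 * j < 2 * n)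
      (h : (∏ i, (X - C (α i))).coeff (n - j) ≠ 0) : j % 4 = 0 := by
    rcases hS _ (sub_mem_of_coeff_ne_zero hα hj (by omega) h) with ⟨h1, h2, h3⟩ | ⟨h1, -, -⟩
    · omega
    · omega
  refine sum_pow_eq_zero α (fun k => k % 4 = 2 ∧ 3 * k < 2 * n) (fun k hk => ?_)
    (fun k j hk hj hjk hc => ?_) ⟨hk, hkn⟩
  · refine ⟨by omega, by omega, ?_⟩
    by_contra hc
    have := key (by omega) hk.2 hc
    omega
  · have := key hj (by omega) hc
    omega

lemma odd_of_mem (hn : Odd n) : ∀ i ∈ S, Odd i := by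
  intro i hi
  rcases hS i hi with h | h
  · exact h.1
  · rw [Nat.odd_iff] at hn ⊢
    omega

omit [IsDomain R] [CharZero R] in
lemma four_dvd_sum_sq (hn : Odd n) (hα : X ^ n + ∑ i ∈ S, X ^ i + 1 = ∏ i, (X - C (α i))) :
    4 ∣ ∑ i, (∑ s ∈ S, ((((s : ℤ) - n) / 2 : ℤ) : R) * α i ^ s) ^ 2 := by
  set c : ℕ → ℤ := fun s => ((s : ℤ) - n) / 2 with hc
  let A : Fin n → R := fun i => ∑ s ∈ S with s % 4 ≠ n % 4, (c s : R) * α i ^ s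
  let B : Fin n → R := fun i => ∑ s ∈ S with ¬ s % 4 ≠ n % 4, ((c s / 2 : ℤ) : R) * α i ^ s
  have hAB (i : Fin n) : ∑ s ∈ S, (c s : R) * α i ^ s = A i + 2 * B i := by
    rw [← Finset.sum_filter_add_sum_filter_not S (fun s => s % 4 ≠ n % 4), Finset.mul_sum]
    refine congrArg _ (Finset.sum_congr rfl fun s hs => ?_)
    have h4 := (Finset.mem_filter.mp hs).2
    have h2 : (2 : ℤ) ∣ c s := by simp only [hc]; omega
    rw [← mul_assoc]
    congr 1
    exact_mod_cast congrArg (Int.cast (R := R)) (Int.mul_ediv_cancel' h2).symm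
  have hA : ∑ i, A i ^ 2 = 0 := by
    simp only [A, sq, Finset.sum_mul_sum]
    rw [Finset.sum_comm]
    refine Finset.sum_eq_zero fun s hs => ?_
    rw [Finset.sum_comm]
    refine Finset.sum_eq_zero fun t ht => ?_
    rw [Finset.mem_filter] at hs ht
    have hso := Nat.odd_iff.mp (odd_of_mem hS hn s hs.1)
    have hto := Nat.odd_iff.mp (odd_of_mem hS hn t ht.1)
    have hno := Nat.odd_iff.mp hn
    have hs' := hS s hs.1
    have ht' := hS t ht.1
    have h0 := sum_pow_eq_zero_of_mod_four hS hα (k := s + t) (by omega) (by omega)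
    calc ∑ i, (c s : R) * α i ^ s * ((c t : R) * α i ^ t)
        = (c s : R) * c t * ∑ i, α i ^ (s + t) := by
          rw [Finset.mul_sum]
          exact Finset.sum_congr rfl fun i _ => by ring
      _ = 0 := by rw [h0, mul_zero]
  refine ⟨∑ i, (A i * B i + B i ^ 2), ?_⟩
  rw [Finset.mul_sum, ← zero_add (∑ i, 4 * _), ← hA, ← Finset.sum_add_distrib]
  refine Finset.sum_congr rfl fun i _ => ?_
  rw [hAB]
  ring

lemma prod_prod_sub_modEq (hn : Odd n)
    (hα : X ^ n + ∑ i ∈ S, X ^ i + 1 = ∏ i, (X - C (α i))) :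
    8 ∣ ∏ i, ∏ j ∈ {i}ᶜ, (α i - α j) - (n : R) := by
  have hodd := odd_of_mem hS hn
  have hu : (8 : R) ∣ (-n : R) ^ 2 - 1 := by
    have := map_dvd (Int.castRingHom R) hn.eight_dvd_sq_sub_one
    simpa using this
  obtain ⟨e, he, w, hw⟩ := prod_add_two_mul_modEq Finset.univ
    (fun i => ∑ s ∈ S, ((((s : ℤ) - n) / 2 : ℤ) : R) * α i ^ s) hu
  have hsum : ∑ i, ∑ s ∈ S, ((((s : ℤ) - n) / 2 : ℤ) : R) * α i ^ s = 0 := by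
    rw [Finset.sum_comm]
    refine Finset.sum_eq_zero fun s hs => ?_
    rw [← Finset.mul_sum, sum_odd_pow_eq_zero hS hn hα (hodd s hs), mul_zero]
    rcases hS s hs with h | h <;> omega
  obtain ⟨z, hz⟩ := four_dvd_sum_sq hS hn hα
  rw [hsum, hz] at he
  have he' : e = -(2 * z) := mul_left_cancel₀ (two_ne_zero (α := R)) (by linear_combination -he)
  rw [hsum, he', ← Finset.prod_congr rfl fun i _ => root_mul_prod_sub_eq hn hodd hα i,
    Finset.prod_mul_distrib, prod_roots_eq hn hodd hα, Finset.card_univ, Fintype.card_fin,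
    hn.neg_pow] at hw
  obtain ⟨v, hv⟩ : (8 : R) ∣ (n : R) ^ n - n := by
    have := map_dvd (Int.castRingHom R) hn.eight_dvd_pow_self_sub
    simpa using this
  exact ⟨v - w - n ^ n * z, by linear_combination hv - hw⟩

/-- Stickelberger's congruence for `∏ (αᵢ - αⱼ)`, made explicit by the trick
`(αᵢ - αⱼ)² = (αᵢ + αⱼ)² (1 - 4 tᵢⱼ)`. -/
lemma natCast_modEq_one_sub_four_mul (hn : Odd n)
    (hα : X ^ n + ∑ i ∈ S, X ^ i + 1 = ∏ i, (X - C (α i))) (t : Fin n → Fin n → R)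
    (ht : ∀ i j, i ≠ j → t i j * (α i + α j) ^ 2 = α i * α j) :
    8 ∣ (-1) ^ (n * (n - 1) / 2) * (1 - 4 * ∑ i, ∑ j ∈ Finset.Ioi i, t i j) - (n : R) := by
  have hpair : ∏ i, ∏ j ∈ {i}ᶜ, (α i - α j) = (-1) ^ (n * (n - 1) / 2) *
      ∏ i, ∏ j ∈ Finset.Ioi i, (1 - 4 * t i j) := by
    have hsign : ∏ i : Fin n, ∏ _j ∈ Finset.Ioi i, (-1 : R) = (-1) ^ (n * (n - 1) / 2) := by
      simp only [Finset.prod_const, Fin.card_Ioi]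
      rw [Finset.prod_pow_eq_pow_sum, Fin.sum_univ_eq_sum_range (fun i => n - 1 - i) n,
        Finset.sum_range_reflect (fun i => i) n, Finset.sum_range_id]
    rw [← Finset.prod_prod_Ioi_mul_eq_prod_prod_off_diag fun j i => α i - α j, ← hsign,
      ← mul_one (∏ i : Fin n, ∏ _j ∈ Finset.Ioi i, (-1 : R))]
    conv_rhs => enter [1, 2]; rw [← prod_prod_add_sq_eq_one hn (odd_of_mem hS hn) hα]
    simp only [← Finset.prod_mul_distrib]
    refine Finset.prod_congr rfl fun i _ => Finset.prod_congr rfl fun j hj => ?_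
    have := ht i j (Finset.mem_Ioi.mp hj).ne
    linear_combination -4 * this
  have hmod := prod_prod_sub_modEq hS hn hα
  have h4 := prod_one_sub_four_mul_modEq (Finset.univ.sigma fun i : Fin n => Finset.Ioi i)
    fun x => t x.1 x.2
  rw [Finset.prod_sigma, Finset.sum_sigma] at h4
  rw [hpair] at hmod
  have := hmod.sub (h4.mul_left ((-1) ^ (n * (n - 1) / 2)))
  convert this using 1
  ring

lemma even_or_odd_pair_sum (hn : Odd n)
    (hα : X ^ n + ∑ i ∈ S, X ^ i + 1 = ∏ i, (X - C (α i))) (t : Fin n → Fin n → R)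
    (ht : ∀ i j, i ≠ j → t i j * (α i + α j) ^ 2 = α i * α j) :
    ((n % 8 = 1 ∨ n % 8 = 7) → 2 ∣ ∑ i, ∑ j ∈ Finset.Ioi i, t i j) ∧
    ((n % 8 = 3 ∨ n % 8 = 5) → 2 ∣ ∑ i, ∑ j ∈ Finset.Ioi i, t i j - 1) := by
  obtain ⟨w, hw⟩ := natCast_modEq_one_sub_four_mul hS hn hα t ht
  obtain ⟨q, r, hr, hnq⟩ : ∃ q r, r < 8 ∧ n = 8 * q + r := ⟨n / 8, n % 8, by omega, by omega⟩
  have hq : (n : R) = 8 * q + r := by rw [hnq]; push_cast; rfl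
  set T := ∑ i, ∑ j ∈ Finset.Ioi i, t i j
  have h4 : (4 : R) ≠ 0 := by norm_num
  have hdiv {m d : ℕ} (h : m = 2 * d) : m / 2 = d := by omega
  refine ⟨?_, ?_⟩ <;> rintro (h | h)
  · obtain rfl : r = 1 := by omega
    have he : n * (n - 1) / 2 = 2 * (2 * q * n) := hdiv (by rw [hnq]; simp; ring)
    rw [he, (even_two_mul _).neg_one_pow, hq] at hw
    refine ⟨-(w + q), mul_left_cancel₀ h4 ?_⟩
    push_cast at hw
    linear_combination -hw
  · obtain rfl : r = 7 := by omega
    have he : n * (n - 1) / 2 = n * (2 * (2 * q + 1) + 1) := hdiv (by rw [hnq]; simp; ring)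
    rw [he, (hn.mul (odd_two_mul_add_one _)).neg_one_pow, hq] at hw
    refine ⟨w + q + 1, mul_left_cancel₀ h4 ?_⟩
    push_cast at hw
    linear_combination hw
  · obtain rfl : r = 3 := by omega
    have he : n * (n - 1) / 2 = n * (2 * (2 * q) + 1) := hdiv (by rw [hnq]; simp; ring)
    rw [he, (hn.mul (odd_two_mul_add_one _)).neg_one_pow, hq] at hw
    refine ⟨w + q, mul_left_cancel₀ h4 ?_⟩
    push_cast at hw
    linear_combination hw
  · obtain rfl : r = 5 := by omega
    have he : n * (n - 1) / 2 = 2 * ((2 * q + 1) * n) := hdiv (by rw [hnq]; simp; ring)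
    rw [he, (even_two_mul _).neg_one_pow, hq] at hw
    refine ⟨-(w + q + 1), mul_left_cancel₀ h4 ?_⟩
    push_cast at hw
    linear_combination -hw

end Discriminant

lemma exists_ringHom_charTwo : ∃ (k : Type) (_ : Field k) (_ : CharP k 2),
    Nonempty (integralClosure ℤ (AlgebraicClosure ℚ) →+* k) := by
  have h2 : (2 : integralClosure ℤ (AlgebraicClosure ℚ)) ∈ nonunits _ := by
    rintro ⟨u, hu⟩
    have hval : (2 : AlgebraicClosure ℚ) * ((u⁻¹ : _ˣ) : integralClosure ℤ (AlgebraicClosure ℚ)) =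
        1 := by
      have := congrArg (algebraMap _ (AlgebraicClosure ℚ)) u.mul_inv
      rw [hu, map_mul, map_one, map_ofNat] at this
      exact this
    have hint : IsIntegral ℤ (algebraMap ℚ (AlgebraicClosure ℚ) (1 / 2)) := by
      have := ((u⁻¹ : _ˣ) : integralClosure ℤ (AlgebraicClosure ℚ)).2
      rw [mem_integralClosure_iff] at this
      rwa [map_div₀, map_one, map_ofNat, one_div, inv_eq_of_mul_eq_one_right hval]
    rw [isIntegral_algebraMap_iff (algebraMap ℚ (AlgebraicClosure ℚ)).injective,
      IsIntegrallyClosed.isIntegral_iff] at hint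
    obtain ⟨z, hz⟩ := hint
    have : (2 * z : ℚ) = 1 := by
      rw [eq_intCast] at hz
      rw [hz]
      norm_num
    norm_cast at this
    omega
  obtain ⟨M, hM, hmem⟩ := exists_max_ideal_of_mem_nonunits h2
  refine ⟨_ ⧸ M, Ideal.Quotient.field M, ?_, ⟨Ideal.Quotient.mk M⟩⟩
  let := Ideal.Quotient.field M
  refine CharTwo.of_one_ne_zero_of_two_eq_zero one_ne_zero ?_
  have := Ideal.Quotient.eq_zero_iff_mem.mpr hmem
  rwa [map_ofNat] at this

lemma exists_roots_in_integralClosure {n : ℕ} {F : ℤ[X]} (hF : F.Monic) (hdeg : F.natDegree = n) :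
    ∃ α : Fin n → integralClosure ℤ (AlgebraicClosure ℚ),
      F.map (algebraMap ℤ _) = ∏ i, (X - C (α i)) := by
  have hprod := (IsAlgClosed.splits (F.map (algebraMap ℤ (AlgebraicClosure ℚ)))).eq_prod_roots_of_monic
    (hF.map _)
  have hcard := (IsAlgClosed.splits
    (F.map (algebraMap ℤ (AlgebraicClosure ℚ)))).natDegree_eq_card_roots
  rw [hF.natDegree_map, hdeg, ← Multiset.coe_toList (F.map _).roots, Multiset.coe_card] at hcard
  rw [← Multiset.coe_toList (F.map _).roots, Multiset.map_coe, Multiset.prod_coe] at hprod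
  have hint : ∀ x ∈ (F.map (algebraMap ℤ (AlgebraicClosure ℚ))).roots.toList,
      x ∈ integralClosure ℤ (AlgebraicClosure ℚ) := by
    intro x hx
    rw [Multiset.mem_toList, mem_roots (hF.map _).ne_zero, IsRoot.def, eval_map] at hx
    exact ⟨F, hF, hx⟩
  generalize (F.map (algebraMap ℤ (AlgebraicClosure ℚ))).roots.toList = l at hprod hcard hint
  subst hcard
  refine ⟨fun i => ⟨l.get i, hint _ (List.get_mem l i)⟩, ?_⟩
  apply Polynomial.map_injective _
    (FaithfulSMul.algebraMap_injective (integralClosure ℤ (AlgebraicClosure ℚ)) (AlgebraicClosure ℚ))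
  rw [Polynomial.map_map, ← IsScalarTower.algebraMap_eq, hprod, Polynomial.map_prod]
  conv_lhs => rw [← List.ofFn_get l, List.map_ofFn, List.prod_ofFn]
  refine Finset.prod_congr rfl fun i _ => ?_
  simp

/-- **Main theorem** (Swan-type result). Let `n` be odd and
`f = x^n + ∑_{i ∈ S} x^i + 1 ∈ 𝔽₂[x]` where every `i ∈ S` is either odd with
`0 < i < n/3`, or satisfies `i ≡ n (mod 4)` with `0 < i < n`.  If `n ≡ ±1 (mod 8)` then
`f` has an odd number of irreducible factors (counted with multiplicity); if
`n ≡ ±3 (mod 8)` then `f` has an even number of irreducible factors. -/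
theorem trinomial_like_factor_parity (n : ℕ) (hodd : Odd n) (hpos : 0 < n)
    (S : Finset ℕ)
    (hS : ∀ i ∈ S, (Odd i ∧ 0 < i ∧ 3 * i < n) ∨ (i % 4 = n % 4 ∧ 0 < i ∧ i < n))
    (f : Polynomial (ZMod 2))
    (hf : f = X ^ n + (∑ i ∈ S, X ^ i) + 1) :
    ((n % 8 = 1 ∨ n % 8 = 7) → Odd (UniqueFactorizationMonoid.factors f).card) ∧
    ((n % 8 = 3 ∨ n % 8 = 5) → Even (UniqueFactorizationMonoid.factors f).card) := by
  obtain ⟨k, _, _, ⟨π⟩⟩ := exists_ringHom_charTwo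
  let : Algebra (ZMod 2) k := ZMod.algebra k 2
  have hlow {A : Type} [CommRing A] [Nontrivial A] :
      ((∑ i ∈ S, X ^ i + 1 : A[X])).degree < (n : WithBot ℕ) := by
    refine (degree_add_le _ _).trans_lt (max_lt ?_ ?_)
    · refine (degree_sum_le S _).trans_lt ((Finset.sup_lt_iff (WithBot.bot_lt_coe n)).mpr ?_)
      intro i hi
      rw [degree_X_pow]
      have : i < n := by rcases hS i hi with h | h <;> omega
      exact WithBot.coe_lt_coe.mpr this
    · rw [degree_one]
      exact_mod_cast hpos
  have hmonic {A : Type} [CommRing A] [Nontrivial A] :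
      (X ^ n + ∑ i ∈ S, X ^ i + 1 : A[X]).Monic := by
    rw [add_assoc]
    exact monic_X_pow_add hlow
  have hdeg {A : Type} [CommRing A] [Nontrivial A] :
      (X ^ n + ∑ i ∈ S, X ^ i + 1 : A[X]).natDegree = n := by
    rw [add_assoc, natDegree_add_eq_left_of_degree_lt (by rw [degree_X_pow]; exact hlow),
      natDegree_X_pow]
  obtain ⟨α, hα⟩ := exists_roots_in_integralClosure (hmonic (A := ℤ)) hdeg
  simp only [Polynomial.map_add, Polynomial.map_pow, map_X, Polynomial.map_sum,
    Polynomial.map_one] at hα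
  have hSodd := odd_of_mem hS hodd
  have hunit {i j : Fin n} (hij : i ≠ j) := isUnit_root_add_root hodd hSodd hα hij
  have hex (i j : Fin n) : ∃ t, i ≠ j → t * (α i + α j) ^ 2 = α i * α j := by
    by_cases hij : i = j
    · exact ⟨0, fun h => absurd hij h⟩
    · obtain ⟨c, hc⟩ := (hunit hij).exists_left_inv
      exact ⟨α i * α j * c ^ 2, fun _ => by
        linear_combination α i * α j * (c * (α i + α j) + 1) * hc⟩
  choose t ht using hex
  have hnd : (List.ofFn (π ∘ α)).Nodup := by
    rw [List.nodup_ofFn]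
    intro i j hij
    by_contra hne
    apply ((hunit hne).map π).ne_zero
    rw [map_add]
    exact CharTwo.add_eq_zero.mpr hij
  have hsplit : f.map (algebraMap (ZMod 2) k) =
      ((List.ofFn (π ∘ α)).map fun a => X - C a).prod := by
    have h := congrArg (Polynomial.map π) hα
    simp only [Polynomial.map_add, Polynomial.map_pow, map_X, Polynomial.map_sum,
      Polynomial.map_one, Polynomial.map_prod, Polynomial.map_sub, map_C] at h
    rw [List.map_ofFn, List.prod_ofFn, hf]
    simpa [Polynomial.map_sum] using h
  have hpair : (List.ofFn (π ∘ α)).pairSum (fun a b => a * b / (a + b) ^ 2) =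
      π (∑ i, ∑ j ∈ Finset.Ioi i, t i j) := by
    rw [List.pairSum_ofFn, map_sum]
    refine Finset.sum_congr rfl fun i _ => ?_
    rw [map_sum]
    refine Finset.sum_congr rfl fun j hj => ?_
    have hij := (Finset.mem_Ioi.mp hj).ne
    have hne := ((hunit hij).map π).ne_zero
    rw [map_add] at hne
    simp only [Function.comp_apply]
    rw [div_eq_iff (pow_ne_zero 2 hne)]
    simpa using (congrArg π (ht i j hij)).symm
  have hf0 : f ≠ 0 := hf ▸ hmonic.ne_zero
  have hfac : (UniqueFactorizationMonoid.factors f).prod = f := by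
    have hassoc := UniqueFactorizationMonoid.factors_prod hf0
    exact eq_of_monic_of_associated (monic_of_ne_zero (hassoc.ne_zero_iff.mpr hf0))
      (monic_of_ne_zero hf0) hassoc
  have hcount := pairSum_roots_eq (k := k) (UniqueFactorizationMonoid.factors f)
    (fun p hp => UniqueFactorizationMonoid.irreducible_of_factor p hp) _ hnd (by rw [hfac, hsplit])
  have hdegf : f.natDegree = n := hf ▸ hdeg
  rw [hpair, hfac, hdegf, ← Nat.cast_add] at hcount
  obtain ⟨h17, h35⟩ := even_or_odd_pair_sum hS hodd hα t ht
  have hπ {x} (hx : 2 ∣ x) : π x = 0 := by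
    obtain ⟨y, rfl⟩ := hx
    rw [map_mul, map_ofNat, CharTwo.two_eq_zero, zero_mul]
  constructor <;> intro h
  · rw [hπ (h17 h), eq_comm, CharP.cast_eq_zero_iff k 2] at hcount
    rw [Nat.odd_iff] at hodd ⊢
    omega
  · have h1 := hπ (h35 h)
    rw [map_sub, map_one, hcount, sub_eq_zero] at h1
    have hne : ¬ 2 ∣ n + (UniqueFactorizationMonoid.factors f).card := by
      rw [← CharP.cast_eq_zero_iff k 2, h1]
      exact one_ne_zero
    rw [Nat.odd_iff] at hodd
    rw [Nat.even_iff]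
    omega
end

section
/- Let n be an odd positive integer and let S be a set of integers with S ⊆ {i : i odd, 0 < i < n/3} ∪ {i : i ≡ n (mod 4), 0 < i < n}. Let f(x) = x^n + Σ_{i∈S} x^i + 1 in F_2[x]. Then f has no repeated roots, i.e., f is squarefree. -/
open Polynomial

/-- In characteristic two, the Euler operator `X * d/dX` fixes odd powers of `X`. -/
theorem X_mul_derivative_X_pow_of_odd {R : Type*} [CommRing R] [CharP R 2] {k : ℕ}
    (hk : Odd k) : (X : R[X]) * derivative (X ^ k) = X ^ k := by
  obtain ⟨m, rfl⟩ := hk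
  have h2 : (2 : R) = 0 := CharTwo.two_eq_zero
  simp [derivative_X_pow, h2, pow_succ, mul_comm]

/-- Let `n` be odd and `f = x^n + ∑_{i ∈ S} x^i + 1 ∈ 𝔽₂[x]` where every `i ∈ S` is either
odd with `0 < i < n/3`, or satisfies `i ≡ n (mod 4)` with `0 < i < n`.  Then `f` has no
repeated roots, i.e. `f` is squarefree. -/
theorem trinomial_like_squarefree (n : ℕ) (hodd : Odd n) (hpos : 0 < n)
    (S : Finset ℕ)
    (hS : ∀ i ∈ S, (Odd i ∧ 0 < i ∧ 3 * i < n) ∨ (i % 4 = n % 4 ∧ 0 < i ∧ i < n))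
    (f : Polynomial (ZMod 2))
    (hf : f = X ^ n + (∑ i ∈ S, X ^ i) + 1) :
    Squarefree f := by
  have hfix : X * derivative f = f - 1 := by
    have hsum : X * ∑ i ∈ S, derivative (X ^ i : (ZMod 2)[X]) = ∑ i ∈ S, X ^ i := by
      rw [Finset.mul_sum]
      refine Finset.sum_congr rfl fun i hi => X_mul_derivative_X_pow_of_odd ?_
      rcases hS i hi with h | h
      · exact h.1
      · rw [Nat.odd_iff] at hodd ⊢
        omega
    rw [hf, derivative_add, derivative_add, derivative_one, derivative_sum, add_zero, mul_add,
      hsum, X_mul_derivative_X_pow_of_odd hodd, add_sub_cancel_right]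
  have hsep : f.Separable := ⟨1, -X, by linear_combination -hfix⟩
  exact hsep.squarefree
end

section
/- Let n be an odd positive integer with n ≡ 3 or n ≡ -3 (mod 8), and let f ∈ F_2[x] be an irreducible polynomial of degree n such that, for a root α of f in F_{2^n}, the trace Tr_{F_{2^n}/F_2}(α^i) = 0 for every i with 1 ≤ i < n. Then f has a nonzero coefficient on x^k for some k with n/3 ≤ k < n. -/
open Polynomial

namespace Matrix

theorem detp_submatrix_left {m R : Type*} [Fintype m] [DecidableEq m] [CommRing R]
    (s : ℤˣ) (M : Matrix m m R) (τ : Equiv.Perm m) :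
    (M.submatrix τ id).detp s = M.detp (Equiv.Perm.sign τ * s) := by
  have h := M.detp_submatrix_equiv_equiv s τ (Equiv.refl m)
  rw [Equiv.coe_refl] at h
  rw [h, Equiv.trans_refl, ← Equiv.Perm.inv_def, Equiv.Perm.sign_inv, mul_comm]

theorem map_detp {m R S : Type*} [Fintype m] [DecidableEq m] [CommRing R] [CommRing S]
    (s : ℤˣ) (M : Matrix m m R) (g : R →+* S) : g (M.detp s) = (M.map g).detp s := by
  simp [detp, map_sum, map_prod]

theorem det_vandermonde_sq {n : ℕ} {R : Type*} [CommRing R] (x : Fin n → R) :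
    (vandermonde x).det ^ 2 =
      (-1) ^ (n * (n - 1) / 2) * ∏ i, ∏ j ∈ {i}ᶜ, (x i - x j) := by
  have hsign : (-1 : R) ^ (n * (n - 1) / 2) = ∏ i : Fin n, ∏ _j ∈ Finset.Ioi i, (-1 : R) := by
    simp only [Finset.prod_const, Fin.card_Ioi, Finset.prod_pow_eq_pow_sum]
    rw [Fin.sum_univ_eq_sum_range (fun i ↦ n - 1 - i), Finset.sum_range_reflect (fun i ↦ i),
      Finset.sum_range_id]
  rw [← Finset.prod_prod_Ioi_mul_eq_prod_prod_off_diag (fun i j ↦ x j - x i), hsign,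
    det_vandermonde, ← Finset.prod_pow, ← Finset.prod_mul_distrib]
  refine Finset.prod_congr rfl fun i _ ↦ ?_
  rw [← Finset.prod_pow, ← Finset.prod_mul_distrib]
  exact Finset.prod_congr rfl fun j _ ↦ by ring

end Matrix

/-- The values of the integral elementary symmetric polynomials at the roots of a polynomial. -/
theorem aeval_esymm_of_prod_X_sub_C_eq {n : ℕ} {S : Type*} [CommRing S] {F : ℤ[X]}
    {x : Fin n → S} (hx : ∏ i, (X - C (x i)) = F.map (Int.castRingHom S)) {k : ℕ} (hk : k ≤ n) :
    MvPolynomial.aeval x (MvPolynomial.esymm (Fin n) ℤ k) =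
      (((-1) ^ k * F.coeff (n - k) : ℤ) : S) := by
  have hcard : Multiset.card (Finset.univ.val.map x) = n := by simp
  have h := Multiset.prod_X_sub_C_coeff (Finset.univ.val.map x) (k := n - k) (by omega)
  rw [Multiset.map_map, hcard, Nat.sub_sub_self hk] at h
  change (∏ i, (X - C (x i))).coeff (n - k) = _ at h
  rw [hx, coeff_map, eq_intCast] at h
  rw [MvPolynomial.aeval_esymm_eq_multiset_esymm, Int.cast_mul, h, ← mul_assoc]
  push_cast
  rw [← mul_pow]
  simp

theorem exists_intCast_eq_aeval_of_isSymmetric {n : ℕ} {P : MvPolynomial (Fin n) ℤ}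
    (hP : P.IsSymmetric) (F : ℤ[X]) :
    ∃ t : ℤ, ∀ (S : Type) [CommRing S] (x : Fin n → S),
      ∏ i, (X - C (x i)) = F.map (Int.castRingHom S) → MvPolynomial.aeval x P = (t : S) := by
  obtain ⟨Q, hQ⟩ := MvPolynomial.esymmAlgHom_fin_surjective ℤ (le_refl n) ⟨P, hP⟩
  have hQ' := MvPolynomial.esymmAlgHom_apply (σ := Fin n) (R := ℤ) Q
  rw [hQ] at hQ'
  refine ⟨MvPolynomial.aeval (fun i : Fin n ↦ (-1) ^ (i + 1 : ℕ) * F.coeff (n - (i + 1))) Q,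
    fun S _ x hx ↦ ?_⟩
  change P = _ at hQ'
  rw [hQ', MvPolynomial.comp_aeval_apply, ← eq_intCast (algebraMap ℤ S),
    ← MvPolynomial.aeval_algebraMap_apply]
  congr 2
  ext i
  rw [aeval_esymm_of_prod_X_sub_C_eq hx i.2]
  simp

theorem vandermonde_X_map_aeval {n : ℕ} {S : Type*} [CommRing S] (x : Fin n → S) (s : ℤˣ) :
    MvPolynomial.aeval x ((Matrix.vandermonde (MvPolynomial.X (R := ℤ))).detp s) =
      (Matrix.vandermonde x).detp s := by
  rw [← AlgHom.coe_toRingHom, Matrix.map_detp]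
  congr 1
  ext i j
  simp [Matrix.vandermonde_apply]

theorem rename_detp_vandermonde_X {n : ℕ} (s : ℤˣ) (τ : Equiv.Perm (Fin n)) :
    MvPolynomial.rename τ ((Matrix.vandermonde (MvPolynomial.X (R := ℤ))).detp s) =
      (Matrix.vandermonde (MvPolynomial.X (R := ℤ))).detp (Equiv.Perm.sign τ * s) := by
  rw [← Matrix.detp_submatrix_left, ← AlgHom.coe_toRingHom, Matrix.map_detp]
  congr 1
  ext i j
  simp [Matrix.vandermonde_apply]

theorem isSymmetric_detp_add {n : ℕ} :
    ((Matrix.vandermonde (MvPolynomial.X (R := ℤ) (σ := Fin n))).detp 1 +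
      (Matrix.vandermonde (MvPolynomial.X (R := ℤ))).detp (-1)).IsSymmetric := by
  intro τ
  rw [map_add, rename_detp_vandermonde_X, rename_detp_vandermonde_X]
  rcases Int.units_eq_one_or (Equiv.Perm.sign τ) with h | h <;> simp [h, add_comm]

theorem isSymmetric_detp_mul {n : ℕ} :
    ((Matrix.vandermonde (MvPolynomial.X (R := ℤ) (σ := Fin n))).detp 1 *
      (Matrix.vandermonde (MvPolynomial.X (R := ℤ))).detp (-1)).IsSymmetric := by
  intro τ
  rw [map_mul, rename_detp_vandermonde_X, rename_detp_vandermonde_X]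
  rcases Int.units_eq_one_or (Equiv.Perm.sign τ) with h | h <;> simp [h, mul_comm]

/-- If, modulo `2`, the squaring map permutes the roots of `F` cyclically and their number is odd,
then the discriminant of `F` is `1` modulo `8`. -/
theorem exists_det_vandermonde_sq_eq {n : ℕ} (hn : Odd n) {F : ℤ[X]} {K : Type} [Field K]
    [CharP K 2] {y : Fin n → K} (hy : ∏ i, (X - C (y i)) = F.map (Int.castRingHom K))
    (hinj : Function.Injective y) (hfrob : ∀ i, y (finRotate n i) = y i ^ 2)
    {S : Type} [CommRing S] {x : Fin n → S}
    (hx : ∏ i, (X - C (x i)) = F.map (Int.castRingHom S)) :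
    ∃ D : ℤ, D % 8 = 1 ∧ (Matrix.vandermonde x).det ^ 2 = (D : S) := by
  obtain ⟨s, hs⟩ := exists_intCast_eq_aeval_of_isSymmetric (isSymmetric_detp_add (n := n)) F
  obtain ⟨t, ht⟩ := exists_intCast_eq_aeval_of_isSymmetric (isSymmetric_detp_mul (n := n)) F
  have hsx := hs S x hx
  have htx := ht S x hx
  have hsy := hs K y hy
  have hty := ht K y hy
  simp only [map_add, map_mul, vandermonde_X_map_aeval] at hsx htx hsy hty
  have hsq (u : ℤˣ) : (Matrix.vandermonde y).detp u ^ 2 = (Matrix.vandermonde y).detp u := by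
    have hrot : Equiv.Perm.sign (finRotate n) = 1 := by
      rw [sign_finRotate, Even.neg_one_pow]
      obtain ⟨m, rfl⟩ := hn
      simp
    rw [← frobenius_def, Matrix.map_detp]
    conv_rhs => rw [← one_mul u, ← hrot, ← Matrix.detp_submatrix_left]
    congr 1
    ext i j
    rw [Matrix.map_apply, Matrix.submatrix_apply, Matrix.vandermonde_apply,
      Matrix.vandermonde_apply, hfrob, frobenius_def, id, ← pow_mul, ← pow_mul, mul_comm]
  have hdet := Matrix.det_vandermonde_ne_zero_iff.2 hinj
  rw [Matrix.det_eq_detp_sub_detp, CharTwo.sub_eq_add, hsy] at hdet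
  have h2 : (2 : K) = 0 := CharTwo.two_eq_zero
  have ht0 : (t : K) = 0 := by
    refine (mul_eq_zero.1 ?_).resolve_right hdet
    rw [← hty, ← hsy]
    linear_combination (Matrix.vandermonde y).detp (-1) * hsq 1 +
      (Matrix.vandermonde y).detp 1 * hsq (-1) +
      (Matrix.vandermonde y).detp 1 * (Matrix.vandermonde y).detp (-1) * h2
  rw [Ne, CharP.intCast_eq_zero_iff K 2] at hdet
  rw [CharP.intCast_eq_zero_iff K 2] at ht0
  refine ⟨s ^ 2 - 4 * t, ?_, ?_⟩
  · obtain ⟨t', rfl⟩ := ht0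
    obtain ⟨m, rfl⟩ : Odd s := by
      rw [← Int.not_even_iff_odd, even_iff_two_dvd]
      exact_mod_cast hdet
    obtain ⟨c, hc⟩ := Int.even_mul_succ_self m
    have : (2 * m + 1) ^ 2 = 8 * c + 1 := by linear_combination 4 * hc
    push_cast
    omega
  · push_cast
    rw [← hsx, ← htx, Matrix.det_eq_detp_sub_detp]
    ring

theorem mul_aeval_esymm_eq_zero {n : ℕ} {S : Type*} [CommRing S] {x : Fin n → S} {k : ℕ}
    (h : ∀ j, 1 ≤ j → j ≤ k → ∑ i, x i ^ j = 0) :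
    (k : S) * MvPolynomial.aeval x (MvPolynomial.esymm (Fin n) ℤ k) = 0 := by
  have := congrArg (MvPolynomial.aeval x) (MvPolynomial.mul_esymm_eq_sum (Fin n) ℤ k)
  rw [map_mul, map_natCast, map_mul, map_sum] at this
  rw [this, Finset.sum_eq_zero, mul_zero]
  intro a ha
  rw [Finset.mem_filter, Finset.HasAntidiagonal.mem_antidiagonal] at ha
  have h0 : MvPolynomial.aeval x (MvPolynomial.psum (Fin n) ℤ a.2) = 0 := by
    simpa [MvPolynomial.psum] using h a.2 (by omega) (by omega)
  rw [map_mul, h0, mul_zero]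

theorem sum_pow_eq_zero_of_aeval_esymm {n : ℕ} {S : Type*} [CommRing S] {x : Fin n → S} {k : ℕ}
    (hk : 0 < k)
    (h : ∀ j, 1 ≤ j → j ≤ k → MvPolynomial.aeval x (MvPolynomial.esymm (Fin n) ℤ j) = 0) :
    ∑ i, x i ^ k = 0 := by
  have := congrArg (MvPolynomial.aeval x) (MvPolynomial.psum_eq_mul_esymm_sub_sum (Fin n) ℤ k hk)
  rw [map_sub, map_mul, h k hk le_rfl, map_sum, Finset.sum_eq_zero, mul_zero, sub_zero] at this
  · simpa [MvPolynomial.psum] using this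
  · intro a ha
    rw [Finset.mem_filter, Finset.HasAntidiagonal.mem_antidiagonal, Set.mem_Ioo] at ha
    rw [map_mul, map_mul, h a.1 (by omega) (by omega), mul_zero, zero_mul]

/-- The product of the `c + 2 * u i` modulo `8`. -/
theorem exists_prod_add_two_mul_eq {ι S : Type*} [CommRing S] (c : S) (u : ι → S) (s : Finset ι) :
    ∃ e r : S, 2 * e = (∑ i ∈ s, u i) ^ 2 - ∑ i ∈ s, u i ^ 2 ∧
      c ^ 2 * ∏ i ∈ s, (c + 2 * u i) =
        c ^ s.card * (c ^ 2 + 2 * c * ∑ i ∈ s, u i + 4 * e) + 8 * r := by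
  classical
  induction s using Finset.induction_on with
  | empty => exact ⟨0, 0, by simp, by simp⟩
  | insert a s ha ih =>
    obtain ⟨e, r, he, hr⟩ := ih
    refine ⟨e + u a * ∑ i ∈ s, u i, c ^ s.card * u a * e + r * (c + 2 * u a), ?_, ?_⟩
    · rw [Finset.sum_insert ha, Finset.sum_insert ha]
      linear_combination he
    · rw [Finset.sum_insert ha, Finset.prod_insert ha, Finset.card_insert_of_notMem ha]
      linear_combination (c + 2 * u a) * hr

theorem injective_pow_two_pow {n : ℕ} {f : (ZMod 2)[X]} (hirr : Irreducible f)
    (hdeg : f.natDegree = n) {L : Type*} [Field L] [Algebra (ZMod 2) L] {α : L}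
    (hroot : aeval α f = 0) : Function.Injective fun i : Fin n ↦ α ^ 2 ^ (i : ℕ) := by
  have : CharP L 2 := charP_of_injective_algebraMap' (ZMod 2) 2
  have key (i j : ℕ) (hij : i < j) (hj : j < n) : α ^ 2 ^ i ≠ α ^ 2 ^ j := by
    intro h
    have hfix : α ^ 2 ^ (j - i) = α := by
      apply iterateFrobenius_inj L 2 i
      rw [iterateFrobenius_def, iterateFrobenius_def, ← pow_mul, ← pow_add, h,
        Nat.sub_add_cancel hij.le]
    have hdvd : f ∣ X ^ Nat.card (ZMod 2) ^ (j - i) - X := by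
      refine ((minpoly.irreducible (IsAlgebraic.isIntegral ⟨f, hirr.ne_zero, hroot⟩)
        ).associated_of_dvd hirr (minpoly.dvd _ _ hroot)).dvd_iff_dvd_left.1 (minpoly.dvd _ _ ?_)
      simp [hfix]
    have := Nat.le_of_dvd (by omega) (hirr.natDegree_dvd_of_dvd_X_pow_card_pow_sub_X hdvd)
    omega
  intro i j h
  rcases lt_trichotomy (i : ℕ) j with hij | hij | hij
  · exact absurd h (key _ _ hij j.2)
  · exact Fin.ext hij
  · exact absurd h.symm (key _ _ hij i.2)

theorem prod_X_sub_C_pow_two_pow {n : ℕ} {f : (ZMod 2)[X]} (hirr : Irreducible f)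
    (hmonic : f.Monic) (hdeg : f.natDegree = n) {L : Type*} [Field L] [Algebra (ZMod 2) L] {α : L}
    (hroot : aeval α f = 0) :
    ∏ i : Fin n, (X - C (α ^ 2 ^ (i : ℕ))) = f.map (algebraMap (ZMod 2) L) := by
  have : CharP L 2 := charP_of_injective_algebraMap' (ZMod 2) 2
  refine (eq_of_monic_of_dvd_of_natDegree_le (monic_prod_X_sub_C _ _) (hmonic.map _) ?_ ?_).symm
  · refine Finset.prod_dvd_of_coprime
      ((pairwise_coprime_X_sub_C (injective_pow_two_pow hirr hdeg hroot)).set_pairwise _) ?_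
    intro i _
    rw [dvd_iff_isRoot, IsRoot, eval_map_algebraMap, ← iterateFrobenius_def]
    have h := congrArg (iterateFrobenius L 2 i) hroot
    rw [map_zero, aeval_def, hom_eval₂] at h
    rw [aeval_def, ← h]
    congr 1
    exact Subsingleton.elim _ _
  · rw [natDegree_map, natDegree_prod_of_monic _ _ fun i _ ↦ monic_X_sub_C _]
    simp only [natDegree_X_sub_C]
    simp [hdeg]

theorem exists_coeff_eq_val (f : (ZMod 2)[X]) :
    ∃ F : ℤ[X], ∀ k, F.coeff k = ((f.coeff k).val : ℤ) := by
  refine ⟨∑ k ∈ f.support, monomial k ((f.coeff k).val : ℤ), fun k ↦ ?_⟩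
  simp +contextual [coeff_monomial]

theorem exists_prod_X_sub_C_integralClosure {F : ℤ[X]} (hF : F.Monic) {n : ℕ}
    (hdeg : F.natDegree = n) : ∃ x : Fin n → integralClosure ℤ ℂ,
      ∏ i, (X - C (x i)) = F.map (Int.castRingHom (integralClosure ℤ ℂ)) := by
  have hsplit := IsAlgClosed.splits (F.map (Int.castRingHom ℂ))
  have hprod := hsplit.eq_prod_roots_of_monic (hF.map _)
  have hcard := hsplit.natDegree_eq_card_roots
  rw [hF.natDegree_map, hdeg] at hcard
  obtain ⟨l, hl⟩ := Quot.exists_rep (F.map (Int.castRingHom ℂ)).roots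
  change (l : Multiset ℂ) = _ at hl
  rw [← hl] at hprod hcard
  rw [Multiset.coe_card] at hcard
  subst hcard
  have hint (i : Fin l.length) : IsIntegral ℤ l[i] := by
    refine ⟨F, hF, ?_⟩
    have : l[i] ∈ (F.map (Int.castRingHom ℂ)).roots := by
      rw [← hl]
      exact l.getElem_mem _
    rw [mem_roots', IsRoot, eval_map] at this
    exact this.2
  refine ⟨fun i ↦ ⟨l[i], (mem_integralClosure_iff ℤ ℂ).2 (hint i)⟩, ?_⟩
  apply map_injective (algebraMap (integralClosure ℤ ℂ) ℂ) Subtype.val_injective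
  rw [map_map, Polynomial.map_prod]
  simp only [Polynomial.map_sub, map_X, map_C]
  rw [Subsingleton.elim ((algebraMap (integralClosure ℤ ℂ) ℂ).comp (Int.castRingHom _))
    (Int.castRingHom ℂ)]
  conv_rhs => rw [hprod, Multiset.map_coe, Multiset.prod_coe]
  rw [← List.ofFn_getElem_eq_map l (fun a ↦ X - C a), List.prod_ofFn]
  rfl

theorem dvd_of_intCast_dvd_integralClosure {a m : ℤ}
    (h : (a : integralClosure ℤ ℂ) ∣ (m : integralClosure ℤ ℂ)) : a ∣ m := by
  rcases eq_or_ne a 0 with rfl | ha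
  · simpa using h
  obtain ⟨r, hr⟩ := h
  have hr' : (m : ℂ) = a * (r : ℂ) := by exact_mod_cast congrArg Subtype.val hr
  have hq : IsIntegral ℤ ((m : ℚ) / a) := by
    rw [← isIntegral_algebraMap_iff (algebraMap ℚ ℂ).injective]
    have : (a : ℂ) ≠ 0 := by exact_mod_cast ha
    rw [map_div₀, map_intCast, map_intCast, hr', mul_div_cancel_left₀ _ this]
    exact r.2
  obtain ⟨z, hz⟩ := IsIntegrallyClosed.isIntegral_iff.1 hq
  refine ⟨z, ?_⟩
  have : (a : ℚ) ≠ 0 := by exact_mod_cast ha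
  simp at hz
  field_simp at hz
  rw [mul_comm]
  exact_mod_cast hz.symm

theorem eval_derivative_prod_X_sub_C {ι R : Type*} [CommRing R] [Fintype ι] [DecidableEq ι]
    (x : ι → R) (i : ι) :
    (derivative (∏ j, (X - C (x j)))).eval (x i) = ∏ j ∈ {i}ᶜ, (x i - x j) := by
  rw [Fintype.prod_eq_mul_prod_compl i]
  simp [derivative_mul, eval_prod]

/-- The discriminant modulo `8` of a polynomial of odd degree `n` and constant coefficient `1`
whose other non-leading terms have odd degree less than `n / 3`. -/
theorem eight_dvd_det_vandermonde_sq_sub {n : ℕ} (hn : Odd n) {F : ℤ[X]} (hF : F.Monic)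
    (hdeg : F.natDegree = n) (hzero : F.coeff 0 = 1)
    (heven : ∀ k, 0 < k → k < n → Even k → F.coeff k = 0)
    (hlarge : ∀ k, n ≤ 3 * k → k < n → F.coeff k = 0)
    {S : Type*} [CommRing S] [IsDomain S] [CharZero S] {x : Fin n → S}
    (hx : ∏ i, (X - C (x i)) = F.map (Int.castRingHom S)) :
    (8 : S) ∣ n ^ 2 * (Matrix.vandermonde x).det ^ 2 -
      (-1) ^ (n * (n - 1) / 2) * n ^ (n + 2) := by
  have hn0 : 0 < n := hn.pos
  have hlead : F.coeff n = 1 := by rw [← hdeg]; exact hF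
  have hpow (k : ℕ) (hk : 0 < k) (hkn : 3 * k < 2 * n) : ∑ i, x i ^ k = 0 := by
    refine sum_pow_eq_zero_of_aeval_esymm hk fun j hj hjk ↦ ?_
    rw [aeval_esymm_of_prod_X_sub_C_eq hx (by omega), hlarge (n - j) (by omega) (by omega)]
    simp
  have hb (k : ℕ) : ∃ b : ℤ, (0 < k → k < n → (n - k : ℤ) * F.coeff k = 2 * b) ∧
      (n ≤ 3 * k → b = 0) := by
    by_cases hk : 0 < k ∧ k < n ∧ 3 * k < n
    · by_cases hk2 : Even k
      · exact ⟨0, fun _ _ ↦ by rw [heven k hk.1 hk.2.1 hk2]; simp, fun _ ↦ rfl⟩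
      · obtain ⟨m, hm⟩ : Even (n - k : ℤ) := by
          rw [Int.even_sub, Int.even_coe_nat, Int.even_coe_nat]
          simp [hk2, Nat.not_even_iff_odd.2 hn]
        exact ⟨m * F.coeff k, fun _ _ ↦ by rw [hm]; ring, fun _ ↦ by omega⟩
    · refine ⟨0, fun h0 h1 ↦ ?_, fun _ ↦ rfl⟩
      rw [hlarge k (by omega) h1]
      simp
  choose b hb hb0 using hb
  let h : Fin n → S := fun i ↦ ∑ k ∈ Finset.Ico 1 n, (b k : S) * x i ^ k
  have hsum : ∑ i, h i = 0 := by
    rw [Finset.sum_comm]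
    refine Finset.sum_eq_zero fun k hk ↦ ?_
    rw [Finset.mem_Ico] at hk
    rw [← Finset.mul_sum]
    by_cases hkn : n ≤ 3 * k
    · simp [hb0 k hkn]
    · rw [hpow k (by omega) (by omega), mul_zero]
  have hsum2 : ∑ i, h i ^ 2 = 0 := by
    simp only [h, sq, Finset.sum_mul_sum]
    rw [Finset.sum_comm]
    refine Finset.sum_eq_zero fun k hk ↦ ?_
    rw [Finset.sum_comm]
    refine Finset.sum_eq_zero fun l hl ↦ ?_
    rw [Finset.mem_Ico] at hk hl
    simp only [mul_mul_mul_comm _ _ (b l : S), ← pow_add]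
    rw [← Finset.mul_sum]
    by_cases hkn : n ≤ 3 * k
    · simp [hb0 k hkn]
    by_cases hln : n ≤ 3 * l
    · simp [hb0 l hln]
    rw [hpow (k + l) (by omega) (by omega), mul_zero]
  have hexp : F.map (Int.castRingHom S) =
      1 + ∑ k ∈ Finset.Ico 1 n, C (F.coeff k : S) * X ^ k + X ^ n := by
    rw [(F.map (Int.castRingHom S)).as_sum_range' (n + 1)
      (by rw [hF.natDegree_map, hdeg]; exact n.lt_succ_self), Finset.sum_range_succ,
      Finset.range_eq_Ico, Finset.sum_eq_sum_Ico_succ_bot hn0]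
    simp [hlead, hzero, ← C_mul_X_pow_eq_monomial]
  have hderiv (i : Fin n) : x i * ∏ j ∈ {i}ᶜ, (x i - x j) = -(n + 2 * h i) := by
    have hroot : (F.map (Int.castRingHom S)).eval (x i) = 0 := by
      rw [← hx, eval_prod]
      exact Finset.prod_eq_zero (Finset.mem_univ i) (by simp)
    rw [← eval_derivative_prod_X_sub_C, hx, hexp]
    rw [hexp] at hroot
    simp only [eval_add, eval_one, eval_finsetSum, eval_mul, eval_C, eval_pow, eval_X] at hroot
    have h1 : x i * eval (x i) (derivative
        (1 + ∑ k ∈ Finset.Ico 1 n, C (F.coeff k : S) * X ^ k + X ^ n)) =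
        ∑ k ∈ Finset.Ico 1 n, (k * F.coeff k : S) * x i ^ k + n * x i ^ n := by
      have hp (k : ℕ) (hk : 0 < k) : x i * x i ^ (k - 1) = x i ^ k := by
        rw [← pow_succ', Nat.sub_add_cancel hk]
      simp only [derivative_add, derivative_one, derivative_sum, derivative_C_mul,
        derivative_X_pow, eval_add, zero_add, eval_finsetSum, eval_mul, eval_C,
        eval_pow, eval_X, mul_add, Finset.mul_sum]
      congr 1
      · refine Finset.sum_congr rfl fun k hk ↦ ?_
        rw [← hp k (Finset.mem_Ico.1 hk).1]
        ring
      · rw [← hp n hn0]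
        ring
    have h2 : 2 * h i = n * ∑ k ∈ Finset.Ico 1 n, (F.coeff k : S) * x i ^ k -
        ∑ k ∈ Finset.Ico 1 n, (k * F.coeff k : S) * x i ^ k := by
      rw [Finset.mul_sum, Finset.mul_sum, ← Finset.sum_sub_distrib]
      refine Finset.sum_congr rfl fun k hk ↦ ?_
      rw [Finset.mem_Ico] at hk
      have : (n - k : S) * F.coeff k = 2 * b k := by
        exact_mod_cast congrArg (Int.cast (R := S)) (hb k hk.1 hk.2)
      linear_combination -x i ^ k * this
    rw [h1, h2]
    linear_combination n * hroot
  have hnorm : ∏ i, x i = -1 := by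
    have := congrArg (eval 0) hx
    rw [← coeff_zero_eq_eval_zero (F.map _), coeff_map, hzero, eval_prod] at this
    simp only [eval_sub, eval_X, eval_C, zero_sub, Finset.prod_neg, Finset.card_univ,
      Fintype.card_fin, hn.neg_one_pow, map_one] at this
    linear_combination -this
  have hprod : ∏ i, ∏ j ∈ {i}ᶜ, (x i - x j) = ∏ i, (n + 2 * h i) := by
    have := Finset.prod_congr (rfl : (Finset.univ : Finset (Fin n)) = _) fun i _ ↦ hderiv i
    rw [Finset.prod_mul_distrib, hnorm, Finset.prod_neg, Finset.card_univ, Fintype.card_fin,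
      hn.neg_one_pow] at this
    linear_combination -this
  obtain ⟨e, r, he, hr⟩ := exists_prod_add_two_mul_eq (n : S) h Finset.univ
  rw [hsum, hsum2] at he
  have he0 : e = 0 := by simpa using he
  rw [hsum, he0, Finset.card_univ, Fintype.card_fin] at hr
  refine ⟨(-1) ^ (n * (n - 1) / 2) * r, ?_⟩
  rw [Matrix.det_vandermonde_sq, hprod]
  linear_combination (-1) ^ (n * (n - 1) / 2) * hr

theorem not_eight_dvd_of_mod_eight {n : ℕ} (hn8 : n % 8 = 3 ∨ n % 8 = 5) {D : ℤ} (hD : D % 8 = 1) :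
    ¬ (8 : ℤ) ∣ n ^ 2 * D - (-1) ^ (n * (n - 1) / 2) * n ^ (n + 2) := by
  rw [← Nat.cast_ofNat, ← ZMod.intCast_zmod_eq_zero_iff_dvd]
  have hD' : (D : ZMod 8) = 1 := by
    rw [← Int.cast_one, ZMod.intCast_eq_intCast_iff']
    simpa using hD
  push_cast
  rw [hD']
  rcases hn8 with h | h
  · obtain ⟨q, rfl⟩ : ∃ q, n = 8 * q + 3 := ⟨n / 8, by omega⟩
    have h1 : (8 * q + 3) * (8 * q + 3 - 1) / 2 = 2 * (16 * q ^ 2 + 10 * q + 1) + 1 := by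
      rw [show 8 * q + 3 - 1 = 2 * (4 * q + 1) by omega, mul_left_comm,
        Nat.mul_div_cancel_left _ two_pos]
      ring
    have h2 : ((8 * q + 3 : ℕ) : ZMod 8) = 3 := by
      push_cast
      rw [show (8 : ZMod 8) = 0 from rfl]
      ring
    rw [h1, h2, show 8 * q + 3 + 2 = 2 * (4 * q + 2) + 1 by ring, pow_succ _ (2 * _), pow_mul,
      pow_succ _ (2 * _), pow_mul (3 : ZMod 8), show (3 : ZMod 8) ^ 2 = 1 from rfl]
    simp
    decide
  · obtain ⟨q, rfl⟩ : ∃ q, n = 8 * q + 5 := ⟨n / 8, by omega⟩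
    have h1 : (8 * q + 5) * (8 * q + 5 - 1) / 2 = 2 * ((8 * q + 5) * (2 * q + 1)) := by
      rw [show 8 * q + 5 - 1 = 2 * (2 * (2 * q + 1)) by omega, mul_left_comm,
        Nat.mul_div_cancel_left _ two_pos]
      ring
    have h2 : ((8 * q + 5 : ℕ) : ZMod 8) = 5 := by
      push_cast
      rw [show (8 : ZMod 8) = 0 from rfl]
      ring
    rw [h1, h2, show 8 * q + 5 + 2 = 2 * (4 * q + 3) + 1 by ring, pow_mul, pow_succ _ (2 * _),
      pow_mul (5 : ZMod 8), show (5 : ZMod 8) ^ 2 = 1 from rfl]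
    simp
    decide

/-- **Corollary.** Let `n ≡ ±3 (mod 8)` be odd and let `f ∈ 𝔽₂[x]` be irreducible of
degree `n` such that for a root `α ∈ 𝔽_{2^n}` one has `Tr(α^i) = 0` for all `1 ≤ i < n`.
Then `f` has a nonzero coefficient on `x^k` for some `n/3 ≤ k < n`. -/
theorem corollary_trace_zero_basis (n : ℕ) (hodd : Odd n) (hpos : 0 < n)
    (hn8 : n % 8 = 3 ∨ n % 8 = 5)
    (f : Polynomial (ZMod 2)) (hirr : Irreducible f) (hdeg : f.natDegree = n)
    (α : GaloisField 2 n) (hroot : Polynomial.aeval α f = 0)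
    (htrace : ∀ i : ℕ, 1 ≤ i → i < n →
      Algebra.trace (ZMod 2) (GaloisField 2 n) (α ^ i) = 0) :
    ∃ k : ℕ, n ≤ 3 * k ∧ k < n ∧ f.coeff k ≠ 0 := by
  by_contra! hlarge
  have hone (a : ZMod 2) (ha : a ≠ 0) : a = 1 := by revert a; decide
  have hmonic : f.Monic := hone _ (leadingCoeff_ne_zero.2 hirr.ne_zero)
  obtain ⟨F, hF⟩ := exists_coeff_eq_val f
  have hmap : F.map (Int.castRingHom (ZMod 2)) = f := by
    ext k
    simp [hF]
  have hFdeg : F.natDegree = n := by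
    refine natDegree_eq_of_le_of_coeff_ne_zero ?_ ?_
    · refine natDegree_le_iff_coeff_eq_zero.2 fun k hk ↦ ?_
      rw [hF, coeff_eq_zero_of_natDegree_lt (by omega), ZMod.val_zero, Nat.cast_zero]
    · rw [hF, ← hdeg, coeff_natDegree, hmonic.leadingCoeff]
      decide
  have hFmonic : F.Monic := by
    rw [Monic, leadingCoeff, hFdeg, hF, ← hdeg, coeff_natDegree, hmonic.leadingCoeff]
    rfl
  let y : Fin n → GaloisField 2 n := fun i ↦ α ^ 2 ^ (i : ℕ)
  have hinj : Function.Injective y := injective_pow_two_pow hirr hdeg hroot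
  have hy : ∏ i, (X - C (y i)) = F.map (Int.castRingHom (GaloisField 2 n)) := by
    rw [prod_X_sub_C_pow_two_pow hirr hmonic hdeg hroot, ← hmap, map_map]
    congr 1
  have hfrob (i : Fin n) : y (finRotate n i) = y i ^ 2 := by
    obtain ⟨m, rfl⟩ : ∃ m, n = m + 1 := ⟨n - 1, by omega⟩
    rcases eq_or_ne i (Fin.last m) with rfl | hi
    · have := Fintype.ofFinite (GaloisField 2 (m + 1))
      have := FiniteField.pow_card α
      rw [← Nat.card_eq_fintype_card, GaloisField.card 2 (m + 1) (by omega)] at this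
      simp [y, ← pow_mul, ← pow_succ, this]
    · simp only [y]
      rw [coe_finRotate_of_ne_last hi, pow_succ, pow_mul]
  have hpsum (k : ℕ) (hk : 1 ≤ k) (hkn : k < n) : ∑ i, y i ^ k = 0 := by
    have := FiniteField.algebraMap_trace_eq_sum_pow (ZMod 2) (GaloisField 2 n) (α ^ k)
    rw [htrace k hk hkn, map_zero, GaloisField.finrank 2 hpos.ne', Nat.card_zmod,
      Finset.sum_range] at this
    rw [this]
    exact Finset.sum_congr rfl fun i _ ↦ pow_right_comm _ _ _
  have hzero : F.coeff 0 = 1 := by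
    rw [hF, hone (f.coeff 0)]
    · rfl
    · intro h
      have := degree_eq_degree_of_associated
        (irreducible_X.associated_of_dvd hirr (X_dvd_iff.2 h))
      rw [degree_X, degree_eq_natDegree hirr.ne_zero, hdeg] at this
      have : 1 = n := by exact_mod_cast this
      omega
  have heven (k : ℕ) (hk : 0 < k) (hkn : k < n) (hk2 : Even k) : F.coeff k = 0 := by
    have h := mul_aeval_esymm_eq_zero (x := y) (k := n - k) fun j h1 h2 ↦
      hpsum j h1 (by omega)
    rw [aeval_esymm_of_prod_X_sub_C_eq hy (by omega), Nat.sub_sub_self hkn.le,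
      Int.cast_mul] at h
    have hcast : ((n - k : ℕ) : GaloisField 2 n) ≠ 0 := by
      rw [Ne, CharP.cast_eq_zero_iff _ 2, ← even_iff_two_dvd, Nat.even_sub hkn.le]
      simp [hk2, Nat.not_even_iff_odd.2 hodd]
    have h := (mul_eq_zero.1 h).resolve_left hcast
    rw [Int.cast_pow, Int.cast_neg, Int.cast_one, mul_eq_zero] at h
    have h := h.resolve_left (pow_ne_zero _ (neg_ne_zero.2 one_ne_zero))
    rw [CharP.intCast_eq_zero_iff _ 2, hF] at h
    rw [hF]
    have := ZMod.val_lt (f.coeff k)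
    omega
  obtain ⟨x, hx⟩ := exists_prod_X_sub_C_integralClosure hFmonic hFdeg
  obtain ⟨D, hD, hDx⟩ := exists_det_vandermonde_sq_eq hodd hy hinj hfrob hx
  have h8 := eight_dvd_det_vandermonde_sq_sub hodd hFmonic hFdeg hzero heven
    (fun k h1 h2 ↦ by rw [hF, hlarge k h1 h2]; rfl) hx
  rw [hDx] at h8
  exact not_eight_dvd_of_mod_eight hn8 hD
    (dvd_of_intCast_dvd_integralClosure (by exact_mod_cast h8))
end

section
/- Let n be an odd positive integer with n ≡ 3 or n ≡ -3 (mod 8), and let m_1 > m_2 > m_3 > 0 be odd integers with m_1 < n/3. Then the pentanomial x^n + x^{m_1} + x^{m_2} + x^{m_3} + 1 ∈ F_2[x] has an even number of irreducible factors (counted with multiplicity); in particular it is not irreducible. -/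
open Polynomial

/-- If the fibres of `g` are the cycles of `σ`, then `sign σ` is determined by the parity of
`card α` plus the number of cycles. -/
theorem sign_eq_neg_one_pow_card_add_card_image {α β : Type*} [Fintype α] [DecidableEq α]
    [DecidableEq β] (σ : Equiv.Perm α) (g : α → β)
    (hg : ∀ x y, σ.SameCycle x y ↔ g x = g y) :
    Equiv.Perm.sign σ = (-1) ^ (Fintype.card α + (Finset.univ.image g).card) := by
  have hfix : Set.InjOn g (σ.supportᶜ : Finset α) := by
    intro x hx y hy hxy
    have hx' : Function.IsFixedPt σ x := by simpa [Function.IsFixedPt] using hx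
    exact ((hg x y).2 hxy).eq_of_left hx'
  have hcyc : (σ.support.image g).card = σ.cycleFactorsFinset.card := by
    have h1 : σ.cycleFactorsFinset = σ.support.image σ.cycleOf := by
      ext c
      simp only [Finset.mem_image]
      constructor
      · intro hc
        obtain ⟨x, hx⟩ := (Equiv.Perm.mem_cycleFactorsFinset_iff.1 hc).1.nonempty_support
        refine ⟨x, Equiv.Perm.mem_cycleFactorsFinset_support_le hc hx, ?_⟩
        exact (Equiv.Perm.cycle_is_cycleOf hx hc).symm
      · rintro ⟨x, hx, rfl⟩
        exact Equiv.Perm.cycleOf_mem_cycleFactorsFinset_iff.2 hx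
    have h2 : Function.FactorsThrough σ.cycleOf g := fun x y h => ((hg x y).2 h).cycleOf_eq
    have h3 : ∀ x, Function.extend g σ.cycleOf 1 (g x) = σ.cycleOf x := h2.extend_apply 1
    have h4 : σ.support.image σ.cycleOf =
        (σ.support.image g).image (Function.extend g σ.cycleOf 1) := by
      rw [Finset.image_image]
      exact Finset.image_congr fun x _ => (h3 x).symm
    rw [h1, h4]
    refine (Finset.card_image_of_injOn ?_).symm
    intro b hb c hc hbc
    obtain ⟨x, hx, rfl⟩ := Finset.mem_image.1 (Finset.mem_coe.1 hb)
    obtain ⟨y, hy, rfl⟩ := Finset.mem_image.1 (Finset.mem_coe.1 hc)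
    simp only [h3] at hbc
    exact (hg x y).1 ((Equiv.Perm.sameCycle_iff_cycleOf_eq_of_mem_support hx hy).2 hbc)
  have hun : Finset.univ.image g = σ.support.image g ∪ (σ.supportᶜ).image g := by
    rw [← Finset.image_union, Finset.union_compl]
  have hdisj : Disjoint (σ.support.image g) ((σ.supportᶜ).image g) := by
    rw [Finset.disjoint_left]
    rintro b hb hb'
    obtain ⟨x, hx, rfl⟩ := Finset.mem_image.1 hb
    obtain ⟨y, hy, hxy⟩ := Finset.mem_image.1 hb'
    have hy' : Function.IsFixedPt σ y := by simpa [Function.IsFixedPt] using hy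
    have := ((hg y x).2 hxy).eq_of_left hy'
    subst this
    exact (Finset.mem_compl.1 hy) hx
  rw [hun, Finset.card_union_of_disjoint hdisj, Finset.card_image_of_injOn hfix, hcyc,
    Equiv.Perm.sign_of_cycleType, Equiv.Perm.sum_cycleType, Equiv.Perm.cycleType_def,
    ← Finset.card_add_card_compl σ.support]
  simp only [Multiset.card_map, Finset.card_val]
  rw [show ∀ a b c : ℕ, a + b + (c + b) = (a + c) + 2 * b by intros; ring,
    pow_add _ (_ + _) (2 * _), pow_mul]
  simp

theorem exists_prod_one_add_two_mul_eq {ι A : Type*} [CommRing A] (s : Finset ι)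
    (b : ι → A) : ∃ e t : A, (∑ i ∈ s, b i) ^ 2 - ∑ i ∈ s, b i ^ 2 = 2 * e ∧
      ∏ i ∈ s, (1 + 2 * b i) = 1 + 2 * (∑ i ∈ s, b i) +
        2 * ((∑ i ∈ s, b i) ^ 2 - ∑ i ∈ s, b i ^ 2) + 8 * t := by
  classical
  induction s using Finset.induction_on with
  | empty => exact ⟨0, 0, by simp, by simp⟩
  | insert i s hi ih =>
    obtain ⟨e, t, he, ht⟩ := ih
    rw [Finset.sum_insert hi, Finset.sum_insert hi, Finset.prod_insert hi, ht]
    refine ⟨e + b i * ∑ i ∈ s, b i, t + 2 * t * b i + b i * e, ?_, ?_⟩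
    · linear_combination he
    · linear_combination 4 * b i * he

/-- Newton identities: if the `d` coefficients below the leading one vanish, so do the first
`d` power sums of the roots. -/
theorem sum_pow_eq_zero_of_coeff_eq_zero {A : Type*} [CommRing A] {n d : ℕ} (x : Fin n → A)
    (hd : d ≤ n)
    (hx : ∀ k, 0 < k → k ≤ d → (∏ i, (X - C (x i))).coeff (n - k) = 0) :
    ∀ k, 0 < k → k ≤ d → ∑ i, x i ^ k = 0 := by
  have hes : ∀ k, 0 < k → k ≤ d → MvPolynomial.aeval x (MvPolynomial.esymm (Fin n) ℤ k) = 0 := by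
    intro k hk hkd
    have h := Multiset.prod_X_sub_C_coeff (Finset.univ.val.map x) (k := n - k) (by simp)
    rw [Multiset.map_map] at h
    have h2 := hx k hk hkd
    rw [Finset.prod_eq_multiset_prod] at h2
    rw [MvPolynomial.aeval_esymm_eq_multiset_esymm]
    simp only [Function.comp_def] at h
    rw [h2] at h
    have h3 : n - (n - k) = k := by omega
    simp only [Multiset.card_map, Finset.card_val, Finset.card_univ, Fintype.card_fin, h3] at h
    have h4 : ((-1 : A) ^ k) * (-1) ^ k = 1 := by rw [← mul_pow]; simp
    linear_combination (-(-1) ^ k) * h - (Multiset.map x Finset.univ.val).esymm k * h4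
  intro k hk hkd
  have h := congrArg (MvPolynomial.aeval x) (MvPolynomial.psum_eq_mul_esymm_sub_sum (Fin n) ℤ k hk)
  rw [MvPolynomial.psum, map_sub, map_mul, hes k hk hkd, map_sum, map_sum,
    Finset.sum_eq_zero (s := Finset.filter _ _)] at h
  · simpa using h
  · intro a ha
    simp only [Finset.mem_filter, Set.mem_Ioo] at ha
    rw [map_mul, map_mul, hes a.1 ha.2.1 (by omega)]
    simp

/-- The discriminant of a split monic polynomial in terms of its derivative at the roots. -/
theorem det_vandermonde_sq {A : Type*} [CommRing A] {n : ℕ} (x : Fin n → A) :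
    (Matrix.vandermonde x).det ^ 2 =
      (-1) ^ (n * (n - 1) / 2) * ∏ i, (derivative (∏ j, (X - C (x j)))).eval (x i) := by
  have hder : ∀ i, (derivative (∏ j, (X - C (x j)))).eval (x i) =
      ∏ j ∈ Finset.univ.erase i, (x i - x j) := by
    intro i
    rw [derivative_prod_finset, eval_finsetSum, Finset.sum_eq_single i]
    · simp [eval_prod]
    · intro b _ hb
      rw [eval_mul, eval_prod, Finset.prod_eq_zero (i := i)]
      · simp
      · simp [hb.symm]
      · simp
    · simp
  have hsplit : ∀ i, ∏ j ∈ Finset.univ.erase i, (x i - x j) =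
      (∏ j ∈ Finset.Ioi i, (x i - x j)) * ∏ j ∈ Finset.Iio i, (x i - x j) := by
    intro i
    rw [← Finset.prod_union]
    · congr 1
      ext j
      simp only [Finset.mem_erase, Finset.mem_univ, Finset.mem_union, Finset.mem_Ioi,
        Finset.mem_Iio]
      grind
    · rw [Finset.disjoint_left]
      intro j
      simp only [Finset.mem_Ioi, Finset.mem_Iio]
      grind
  have hswap : ∏ i, ∏ j ∈ Finset.Iio i, (x i - x j) = ∏ i, ∏ j ∈ Finset.Ioi i, (x j - x i) := by
    apply Finset.prod_comm'
    simp
  have hneg : ∏ i, ∏ j ∈ Finset.Ioi i, (x i - x j) =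
      (-1) ^ (n * (n - 1) / 2) * ∏ i, ∏ j ∈ Finset.Ioi i, (x j - x i) := by
    have : ∀ i, ∏ j ∈ Finset.Ioi i, (x i - x j) =
        (-1) ^ (n - 1 - (i : ℕ)) * ∏ j ∈ Finset.Ioi i, (x j - x i) := by
      intro i
      rw [← Fin.card_Ioi, ← Finset.prod_const, ← Finset.prod_mul_distrib]
      simp
    simp_rw [this, Finset.prod_mul_distrib, Finset.prod_pow_eq_pow_sum]
    rw [Fin.sum_univ_eq_sum_range (fun i => n - 1 - i), Finset.sum_range_reflect (fun i => i),
      Finset.sum_range_id]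
  simp_rw [hder, hsplit, Finset.prod_mul_distrib]
  rw [hswap, hneg, Matrix.det_vandermonde]
  have h4 : ((-1 : A) ^ (n * (n - 1) / 2)) * (-1) ^ (n * (n - 1) / 2) = 1 := by
    rw [← mul_pow]; simp
  linear_combination (-(∏ i, ∏ j ∈ Finset.Ioi i, (x j - x i)) ^ 2) * h4

/-- The permutation induced by Frobenius on the roots of a separable polynomial over `𝔽₂` has
one cycle for each irreducible factor. -/
theorem sign_eq_neg_one_pow_add_card_factors {L : Type*} [Field L] [Finite L] [Algebra (ZMod 2) L]
    {n : ℕ} {f : (ZMod 2)[X]} (hf : f.Separable) (y : Fin n → L)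
    (hy : f.map (algebraMap (ZMod 2) L) = ∏ i, (X - C (y i))) (τ : Equiv.Perm (Fin n))
    (hτ : ∀ i, y (τ i) = y i ^ 2) :
    Equiv.Perm.sign τ = (-1) ^ (n + (UniqueFactorizationMonoid.factors f).card) := by
  classical
  have : CharP L 2 := charP_of_injective_algebraMap (algebraMap (ZMod 2) L).injective 2
  have hinj : Function.Injective y := by
    rw [← separable_prod_X_sub_C_iff, ← hy]
    exact hf.map
  have hpow : ∀ (k : ℕ) i, y ((τ ^ k) i) =
      (FiniteField.frobeniusAlgEquivOfAlgebraic (ZMod 2) L ^ k) (y i) := by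
    intro k i
    induction k with
    | zero => simp
    | succ k ih =>
      rw [pow_succ', pow_succ', Equiv.Perm.mul_apply, hτ, ih, AlgEquiv.mul_apply]
      simp [FiniteField.frobeniusAlgEquivOfAlgebraic_apply]
  have hconj : ∀ i j, τ.SameCycle i j ↔ minpoly (ZMod 2) (y i) = minpoly (ZMod 2) (y j) := by
    intro i j
    constructor
    · intro h
      obtain ⟨k, -, rfl⟩ := h.exists_pow_eq'
      rw [hpow]
      exact (minpoly.algEquiv_eq _ _).symm
    · intro h
      obtain ⟨φ, hφ⟩ :=
        isConjRoot_iff_exists_algEquiv.1 (show IsConjRoot (ZMod 2) (y j) (y i) from h.symm)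
      obtain ⟨k, rfl⟩ := (FiniteField.bijective_frobeniusAlgEquivOfAlgebraic_pow (ZMod 2) L).2 φ
      refine ⟨(k : ℕ), hinj ?_⟩
      rw [zpow_natCast, hpow]
      exact hφ
  have hcard : (Finset.univ.image fun i => minpoly (ZMod 2) (y i)).card =
      (UniqueFactorizationMonoid.factors f).card := by
    have h1 : (UniqueFactorizationMonoid.factors f).card =
        (UniqueFactorizationMonoid.normalizedFactors f).card := by
      simp [UniqueFactorizationMonoid.normalizedFactors]
    have h2 : (UniqueFactorizationMonoid.normalizedFactors f).Nodup :=
      (UniqueFactorizationMonoid.squarefree_iff_nodup_normalizedFactors hf.ne_zero).1 hf.squarefree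
    rw [h1, ← Multiset.toFinset_card_of_nodup h2]
    congr 1
    have hroot : ∀ a, aeval a f = 0 ↔ ∃ i, a = y i := by
      intro a
      rw [← eval_map_algebraMap, hy, eval_prod, Finset.prod_eq_zero_iff]
      simp [sub_eq_zero]
    ext g
    rw [Multiset.mem_toFinset, UniqueFactorizationMonoid.mem_normalizedFactors_iff' hf.ne_zero,
      Finset.mem_image]
    constructor
    · rintro ⟨i, -, rfl⟩
      have hi := Algebra.IsIntegral.isIntegral (R := ZMod 2) (y i)
      exact ⟨minpoly.irreducible hi, (minpoly.monic hi).normalize_eq_self,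
        minpoly.dvd _ _ ((hroot _).2 ⟨i, rfl⟩)⟩
    · rintro ⟨hg, hgn, hgf⟩
      have hmonic : g.Monic := by
        rw [← hgn]
        exact monic_normalize hg.ne_zero
      have hsplits : (g.map (algebraMap (ZMod 2) L)).Splits := by
        refine Splits.of_dvd (g := ∏ i, (X - C (y i))) ?_ ?_ ?_
        · exact Splits.prod fun i _ => Splits.X_sub_C _
        · rw [← hy]
          exact Polynomial.map_ne_zero hf.ne_zero
        · rw [← hy]
          exact Polynomial.map_dvd _ hgf
      obtain ⟨a, ha⟩ := hsplits.exists_eval_eq_zero (by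
        rw [degree_map]; exact hg.degree_pos.ne')
      rw [eval_map_algebraMap] at ha
      obtain ⟨i, rfl⟩ := (hroot a).1 (aeval_eq_zero_of_dvd_aeval_eq_zero hgf ha)
      exact ⟨i, Finset.mem_univ _, (minpoly.eq_of_irreducible_of_monic hg ha hmonic).symm⟩
  rw [sign_eq_neg_one_pow_card_add_card_image τ _ hconj, hcard, Fintype.card_fin]

theorem Multiset.exists_eq_map_univ_fin {α : Type*} {n : ℕ} (s : Multiset α) (hs : s.card = n) :
    ∃ z : Fin n → α, s = Finset.univ.val.map z := by
  subst hs
  induction s using Quotient.inductionOn with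
  | h l =>
    exact ⟨l.get, (congrArg _ (List.ofFn_get l).symm).trans (Fin.univ_val_map l.get).symm⟩

/-- A monic integer polynomial splits over an integrally closed domain that carries a lift of
the Frobenius endomorphism of a finite residue field of characteristic two. -/
theorem exists_frobenius_lift (F : ℤ[X]) (hF : F.Monic) :
    ∃ (A : Type) (_ : CommRing A) (_ : IsDomain A) (_ : CharZero A) (_ : IsIntegrallyClosed A)
      (Q : Ideal A) (_ : Q.IsMaximal) (_ : Finite (A ⧸ Q)) (σ : A →+* A)
      (x : Fin F.natDegree → A), (2 : A) ∈ Q ∧ (∀ a, σ a - a ^ 2 ∈ Q) ∧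
      F.map (Int.castRingHom A) = ∏ i, (X - C (x i)) := by
  let p := F.map (Int.castRingHom ℚ)
  let K := p.SplittingField
  have : IsSplittingField ℚ K p := by
    have key : ∀ a b : Algebra ℚ K, @IsSplittingField ℚ K _ _ a p → @IsSplittingField ℚ K _ _ b p :=
      fun a b h => Subsingleton.elim a b ▸ h
    exact key _ _ (IsSplittingField.splittingField p)
  have : IsGalois ℚ K := by
    have : Normal ℚ K := by
      exact Normal.of_isSplittingField p
    exact {}
  have : NumberField K :=
    { to_charZero := inferInstance
      to_finiteDimensional := by
        exact IsSplittingField.finiteDimensional K p }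
  let A := NumberField.RingOfIntegers K
  have hfin : Finite (A ≃ₐ[ℤ] A) := Finite.of_equiv _ (galRestrict ℤ ℚ K A).toEquiv
  have hinv : Algebra.IsInvariant ℤ A (A ≃ₐ[ℤ] A) := Algebra.isInvariant_of_isGalois' ℤ ℚ K A
  have hmax : (Ideal.span {(2 : ℤ)}).IsMaximal :=
    PrincipalIdealRing.isMaximal_of_irreducible Int.prime_two.irreducible
  obtain ⟨Q, hQ, hQ2⟩ :=
    Ideal.exists_maximal_ideal_liesOver_of_isIntegral (S := A) (Ideal.span {(2 : ℤ)})
  have h2 : (2 : A) ∈ Q := by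
    have : (2 : ℤ) ∈ Q.under ℤ := by
      rw [← hQ2.over]
      exact Ideal.mem_span_singleton_self 2
    simpa using this
  have hQ0 : Q ≠ ⊥ := by
    rintro rfl
    simp at h2
  have hQfin : Finite (A ⧸ Q) := Ring.HasFiniteQuotients.finiteQuotient hQ0
  obtain ⟨σ, hσ⟩ := IsArithFrobAt.exists_of_isInvariant ℤ (A ≃ₐ[ℤ] A) Q
  have hcard : Nat.card (ℤ ⧸ Q.under ℤ) = 2 := by
    rw [← hQ2.over]
    exact (Nat.card_congr (Int.quotientSpanNatEquivZMod 2).toEquiv).trans (Nat.card_zmod 2)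
  have hsplits : ((F.map (Int.castRingHom A)).map (algebraMap A K)).Splits := by
    rw [Polynomial.map_map]
    have := SplittingField.splits p
    rw [Polynomial.map_map] at this
    convert this using 2
    exact RingHom.ext_int _ _
  have hroots := hsplits.eq_prod_roots_of_monic ((hF.map _).map _)
  set s := ((F.map (Int.castRingHom A)).map (algebraMap A K)).roots with hs
  have hscard : s.card = F.natDegree := by
    rw [← hsplits.natDegree_eq_card_roots, (hF.map _).natDegree_map, hF.natDegree_map]
  have hsint : ∀ a ∈ s, IsIntegral ℤ a := by
    intro a ha
    refine ⟨F, hF, ?_⟩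
    have := (mem_roots'.1 ha).2
    rw [Polynomial.map_map, IsRoot.def, eval_map] at this
    rwa [RingHom.ext_int ((algebraMap A K).comp (Int.castRingHom A)) (algebraMap ℤ K)] at this
  obtain ⟨z, hz⟩ := s.exists_eq_map_univ_fin hscard
  have hzint : ∀ i, IsIntegral ℤ (z i) := fun i => hsint _ (by simp [hz])
  let x : Fin F.natDegree → A := fun i => ⟨z i, hzint i⟩
  have hx : ∀ i, algebraMap A K (x i) = z i := fun i => rfl
  refine ⟨A, inferInstance, inferInstance, inferInstance, inferInstance, Q, hQ, hQfin, σ, x, h2,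
    fun a => ?_, ?_⟩
  · simpa [hcard] using hσ a
  · apply Polynomial.map_injective (algebraMap A K) (FaithfulSMul.algebraMap_injective A K)
    rw [hroots, Polynomial.map_prod, hz, Multiset.map_map]
    simp [hx, Finset.prod_eq_multiset_prod]

theorem exists_two_mul_eq_one_add {A : Type*} [CommRing A] [IsDomain A] [CharZero A]
    [IsIntegrallyClosed A] {δ t : A} (h : δ ^ 2 = 1 + 4 * t) : ∃ w : A, 2 * w = 1 + δ := by
  have hint : IsIntegral A ((1 + algebraMap A (FractionRing A) δ) / 2) := by
    refine ⟨X ^ 2 - X - C t, by monicity!, ?_⟩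
    have h := congrArg (algebraMap A (FractionRing A)) h
    simp only [map_pow, map_add, map_mul, map_one, map_ofNat] at h
    rw [eval₂_sub, eval₂_sub, eval₂_X_pow, eval₂_X, eval₂_C]
    field_simp
    linear_combination h
  obtain ⟨w, hw⟩ := IsIntegrallyClosed.isIntegral_iff.1 hint
  refine ⟨w, FaithfulSMul.algebraMap_injective A (FractionRing A) ?_⟩
  rw [map_mul, hw, map_add, map_one, map_ofNat]
  field_simp

/-- Theorem of Stickelberger at the prime `2`: if a monic integer polynomial has discriminant
congruent to `5` modulo `8` and is separable modulo `2`, then its degree and the number of its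
irreducible factors modulo `2` have opposite parity. -/
theorem odd_natDegree_add_card_factors {F : ℤ[X]} (hF : F.Monic)
    (hsep : (F.map (Int.castRingHom (ZMod 2))).Separable)
    (hdisc : ∀ (A : Type) [CommRing A] (x : Fin F.natDegree → A),
      F.map (Int.castRingHom A) = ∏ i, (X - C (x i)) →
      ∃ t : A, (Matrix.vandermonde x).det ^ 2 = 5 + 8 * t) :
    Odd (F.natDegree +
      (UniqueFactorizationMonoid.factors (F.map (Int.castRingHom (ZMod 2)))).card) := by
  obtain ⟨A, _, _, _, _, Q, hQ, _, σ, x, h2, hσ, hx⟩ := exists_frobenius_lift F hF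
  let L := A ⧸ Q
  let _ : Field L := Ideal.Quotient.field Q
  let π : A →+* L := Ideal.Quotient.mk Q
  have hπ2 : (2 : L) = 0 := by
    rw [← map_ofNat π 2]
    exact Ideal.Quotient.eq_zero_iff_mem.2 h2
  have : CharP L 2 := CharTwo.of_one_ne_zero_of_two_eq_zero one_ne_zero hπ2
  let _ : Algebra (ZMod 2) L := ZMod.algebra L 2
  have hπσ : ∀ a, π (σ a) = π a ^ 2 := by
    intro a
    rw [← map_pow]
    exact Ideal.Quotient.eq.2 (hσ a)
  have hy : (F.map (Int.castRingHom (ZMod 2))).map (algebraMap (ZMod 2) L) =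
      ∏ i, (X - C (π (x i))) := by
    rw [Polynomial.map_map, RingHom.ext_int ((algebraMap (ZMod 2) L).comp _)
      (π.comp (Int.castRingHom A)), ← Polynomial.map_map, hx, Polynomial.map_prod]
    simp
  have hinj : Function.Injective fun i => π (x i) := by
    rw [← separable_prod_X_sub_C_iff, ← hy]
    exact hsep.map
  have hroot : ∀ i, ∃ j, x j = σ (x i) := by
    intro i
    have h0 : (F.map (Int.castRingHom A)).eval (σ (x i)) = 0 := by
      rw [← RingHom.ext_int (σ.comp (Int.castRingHom A)) (Int.castRingHom A),
        ← Polynomial.map_map, eval_map_apply, hx, eval_prod, Finset.prod_eq_zero (i := i)] <;> simp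
    rw [hx, eval_prod, Finset.prod_eq_zero_iff] at h0
    obtain ⟨j, -, hj⟩ := h0
    exact ⟨j, by simpa [sub_eq_zero, eq_comm (a := x j)] using hj⟩
  choose τ₀ hτ₀ using hroot
  have hσinj : ∀ i j, σ (x i) = σ (x j) → i = j := by
    intro i j hij
    have h1 := congrArg π hij
    rw [hπσ, hπσ] at h1
    exact hinj (frobenius_inj L 2 h1)
  have hτinj : Function.Injective τ₀ := fun i j hij => hσinj i j (by rw [← hτ₀, ← hτ₀, hij])
  let τ : Equiv.Perm (Fin F.natDegree) :=
    Equiv.ofBijective τ₀ (Finite.injective_iff_bijective.1 hτinj)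
  have hτ : ∀ i, x (τ i) = σ (x i) := hτ₀
  have hsign := sign_eq_neg_one_pow_add_card_factors hsep (fun i => π (x i)) hy τ
    (fun i => by rw [hτ, hπσ])
  obtain ⟨t, ht⟩ := hdisc A x hx
  set δ := (Matrix.vandermonde x).det with hδ
  have hσδ : σ δ = (Equiv.Perm.sign τ : ℤ) * δ := by
    rw [hδ, RingHom.map_det, ← Matrix.det_permute]
    congr 1
    ext i j
    simp [Matrix.vandermonde_apply, hτ]
  rw [← Nat.not_even_iff_odd]
  intro heven
  rw [heven.neg_one_pow] at hsign
  rw [hsign] at hσδ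
  obtain ⟨w, hw⟩ : ∃ w : A, 2 * w = 1 + δ :=
    exists_two_mul_eq_one_add (t := 1 + 2 * t) (by linear_combination ht)
  have hw2 : w ^ 2 - w = 1 + 2 * t := by
    apply mul_left_cancel₀ (show (4 : A) ≠ 0 by exact_mod_cast four_ne_zero (α := ℕ))
    linear_combination (2 * w - 1 + δ) * hw + ht
  have hσw : σ w = w := by
    apply mul_left_cancel₀ (two_ne_zero (α := A))
    have := congrArg σ hw
    simp only [map_mul, map_add, map_ofNat, map_one, hσδ] at this
    rw [this, hw]
    simp
  have hone : π 1 = 0 := by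
    have h := hπσ w
    have h' := congrArg π hw2
    rw [hσw] at h
    simp only [map_sub, map_pow, map_add, map_mul, map_ofNat, hπ2] at h'
    linear_combination -h - h'
  simp at hone

theorem exists_prod_add_two_mul_eq_s3 {A : Type*} [CommRing A] {n : ℕ} (hn : Odd n) (β : Fin n → A)
    (h1 : ∑ i, β i = 0) (h2 : ∑ i, β i ^ 2 = 0) :
    ∃ t : A, ∏ i, ((n : A) + 2 * β i) = n + 8 * t := by
  obtain ⟨c, hc⟩ : ∃ c : A, c = n := ⟨_, rfl⟩
  obtain ⟨u, hu⟩ : ∃ u : A, c ^ 2 = 1 + 8 * u := by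
    obtain ⟨u, hu⟩ := Int.eight_dvd_sq_sub_one_of_odd (k := n) (by exact_mod_cast hn)
    have h := congrArg (Int.cast (R := A)) hu
    push_cast at h
    exact ⟨u, by rw [hc]; linear_combination h⟩
  obtain ⟨v, hv⟩ : ∃ v : A, c ^ n = c + 8 * v := by
    obtain ⟨k, hk⟩ := hn
    obtain ⟨v, hv⟩ : (8 : A) ∣ (c ^ 2) ^ k - 1 ^ k :=
      (Dvd.intro u (by rw [hu]; ring)).trans (sub_dvd_pow_sub_pow _ 1 k)
    refine ⟨v * c, ?_⟩
    rw [hk, pow_succ, pow_mul]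
    rw [one_pow] at hv
    linear_combination c * hv
  rw [← hc]
  obtain ⟨-, t, -, ht⟩ := exists_prod_one_add_two_mul_eq Finset.univ
    (fun i => 4 * u + c * β i)
  have hprod : c ^ n * ∏ i, (c + 2 * β i) = ∏ i, (1 + 2 * (4 * u + c * β i)) := by
    have h : c ^ n = ∏ _i : Fin n, c := by simp
    rw [h, ← Finset.prod_mul_distrib]
    exact Finset.prod_congr rfl fun i _ => by linear_combination hu
  have hs1 : ∑ i, (4 * u + c * β i) = 4 * u * n := by
    rw [Finset.sum_add_distrib, ← Finset.mul_sum _ _ c, h1]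
    simp
    ring
  have hs2 : ∑ i, (4 * u + c * β i) ^ 2 = 16 * u ^ 2 * n := by
    have (i : Fin n) : (4 * u + c * β i) ^ 2 =
        16 * u ^ 2 + 8 * u * c * β i + c ^ 2 * β i ^ 2 := by ring
    simp_rw [this]
    rw [Finset.sum_add_distrib, Finset.sum_add_distrib, ← Finset.mul_sum _ β,
      ← Finset.mul_sum _ (fun i => β i ^ 2), h1, h2]
    simp
    ring
  rw [hs1, hs2, ← hprod, hv] at ht
  set P := ∏ i, (c + 2 * β i)
  refine ⟨c * (u * n + 4 * u ^ 2 * n ^ 2 - 4 * u ^ 2 * n + t) - c * v * P - u * P, ?_⟩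
  linear_combination c * ht - P * hu

theorem separable_pentanomial {n m₁ m₂ m₃ : ℕ} (hn : Odd n) (h1 : Odd m₁) (h2 : Odd m₂)
    (h3 : Odd m₃) : (X ^ n + X ^ m₁ + X ^ m₂ + X ^ m₃ + 1 : (ZMod 2)[X]).Separable := by
  have hX : ∀ k : ℕ, Odd k → X * derivative (X ^ k : (ZMod 2)[X]) = X ^ k := by
    intro k hk
    have hk1 : (k : ZMod 2) = 1 := ZMod.natCast_eq_one_iff_odd.2 hk
    obtain ⟨j, rfl⟩ := hk
    rw [derivative_X_pow, hk1, Nat.add_sub_cancel]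
    simp [pow_succ']
  refine ⟨1, -X, ?_⟩
  simp only [derivative_add, derivative_one, add_zero, neg_mul, mul_add, hX _ hn, hX _ h1,
    hX _ h2, hX _ h3]
  ring

/-- The discriminant of the pentanomial is congruent to `5` modulo `8`. -/
theorem exists_det_vandermonde_sq_eq_s3 {n m₁ m₂ m₃ : ℕ} (hn8 : n % 8 = 3 ∨ n % 8 = 5)
    (h1 : Odd m₁) (h2 : Odd m₂) (h3 : Odd m₃)
    (h12 : m₂ < m₁) (h23 : m₃ < m₂) (h3pos : 0 < m₃) (hm1 : 3 * m₁ < n)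
    {A : Type*} [CommRing A] (x : Fin n → A)
    (hx : X ^ n + X ^ m₁ + X ^ m₂ + X ^ m₃ + 1 = ∏ i, (X - C (x i))) :
    ∃ t : A, (Matrix.vandermonde x).det ^ 2 = 5 + 8 * t := by
  have hn : Odd n := by rw [Nat.odd_iff]; omega
  have hpow : ∀ k, 0 < k → k ≤ 2 * m₁ → ∑ i, x i ^ k = 0 := by
    apply sum_pow_eq_zero_of_coeff_eq_zero x (by omega)
    intro k hk hk'
    rw [← hx]
    simp only [coeff_add, coeff_X_pow, coeff_one]
    rw [if_neg (by omega), if_neg (by omega), if_neg (by omega), if_neg (by omega),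
      if_neg (by omega)]
    simp
  obtain ⟨k₁, hk₁⟩ : ∃ k₁, n = m₁ + 2 * k₁ := ⟨(n - m₁) / 2, by grind⟩
  obtain ⟨k₂, hk₂⟩ : ∃ k₂, n = m₂ + 2 * k₂ := ⟨(n - m₂) / 2, by grind⟩
  obtain ⟨k₃, hk₃⟩ : ∃ k₃, n = m₃ + 2 * k₃ := ⟨(n - m₃) / 2, by grind⟩
  have hc₁ : (n : A) = m₁ + 2 * k₁ := by exact_mod_cast congrArg (Nat.cast (R := A)) hk₁
  have hc₂ : (n : A) = m₂ + 2 * k₂ := by exact_mod_cast congrArg (Nat.cast (R := A)) hk₂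
  have hc₃ : (n : A) = m₃ + 2 * k₃ := by exact_mod_cast congrArg (Nat.cast (R := A)) hk₃
  let β : Fin n → A := fun i => k₁ * x i ^ m₁ + k₂ * x i ^ m₂ + k₃ * x i ^ m₃
  have hβ1 : ∑ i, β i = 0 := by
    simp only [β, Finset.sum_add_distrib, ← Finset.mul_sum]
    rw [hpow m₁ (by omega) (by omega), hpow m₂ (by omega) (by omega),
      hpow m₃ (by omega) (by omega)]
    simp
  have hβ2 : ∑ i, β i ^ 2 = 0 := by
    have (i : Fin n) : β i ^ 2 = (k₁ ^ 2 : A) * x i ^ (m₁ + m₁) + (k₂ ^ 2 : A) * x i ^ (m₂ + m₂) +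
        (k₃ ^ 2 : A) * x i ^ (m₃ + m₃) + (2 * k₁ * k₂ : A) * x i ^ (m₁ + m₂) +
        (2 * k₁ * k₃ : A) * x i ^ (m₁ + m₃) + (2 * k₂ * k₃ : A) * x i ^ (m₂ + m₃) := by
      simp only [β]
      ring
    simp only [this, Finset.sum_add_distrib, ← Finset.mul_sum]
    rw [hpow (m₁ + m₁) (by omega) (by omega), hpow (m₂ + m₂) (by omega) (by omega),
      hpow (m₃ + m₃) (by omega) (by omega), hpow (m₁ + m₂) (by omega) (by omega),
      hpow (m₁ + m₃) (by omega) (by omega), hpow (m₂ + m₃) (by omega) (by omega)]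
    simp
  obtain ⟨t, ht⟩ := exists_prod_add_two_mul_eq_s3 hn β hβ1 hβ2
  have hneg : ∏ i, -x i = 1 := by
    have h := congrArg (eval 0) hx
    rw [eval_prod] at h
    simpa [zero_pow (show n ≠ 0 by omega), zero_pow (show m₁ ≠ 0 by omega),
      zero_pow (show m₂ ≠ 0 by omega), zero_pow (show m₃ ≠ 0 by omega)] using h.symm
  have hX (k : ℕ) (hk : 0 < k) (a : A) : a * (derivative (X ^ k : A[X])).eval a = k * a ^ k := by
    obtain ⟨j, rfl⟩ := Nat.exists_eq_succ_of_ne_zero hk.ne'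
    rw [derivative_X_pow, eval_C_mul, eval_X_pow, Nat.succ_sub_one, pow_succ]
    ring
  have hder (i : Fin n) : -x i * (derivative (∏ j, (X - C (x j)))).eval (x i) = n + 2 * β i := by
    have hroot : x i ^ n + x i ^ m₁ + x i ^ m₂ + x i ^ m₃ + 1 = 0 := by
      have h := congrArg (eval (x i)) hx
      rw [eval_prod, Finset.prod_eq_zero (Finset.mem_univ i) (by simp)] at h
      simpa using h
    rw [← hx]
    simp only [derivative_add, derivative_one, add_zero, eval_add, neg_mul, mul_add]
    rw [hX n (by omega), hX m₁ (by omega), hX m₂ (by omega), hX m₃ (by omega)]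
    simp only [β]
    linear_combination (-(n : A)) * hroot + x i ^ m₁ * hc₁ + x i ^ m₂ * hc₂ + x i ^ m₃ * hc₃
  have hprod : ∏ i, (derivative (∏ j, (X - C (x j)))).eval (x i) = n + 8 * t := by
    rw [← ht, ← one_mul (∏ i, _), ← hneg, ← Finset.prod_mul_distrib]
    exact Finset.prod_congr rfl fun i _ => hder i
  rw [det_vandermonde_sq, hprod]
  obtain ⟨q, hq⟩ : ∃ q, q = n / 8 := ⟨_, rfl⟩
  rcases hn8 with h | h
  · have hnq : n = 8 * q + 3 := by omega
    have hodd : Odd (n * (n - 1) / 2) := by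
      have : n * (n - 1) / 2 = n * (4 * q + 1) := by
        rw [show n - 1 = (4 * q + 1) * 2 by omega, ← mul_assoc, Nat.mul_div_cancel _ two_pos]
      rw [this]
      exact hn.mul ⟨2 * q, by ring⟩
    have hcast : (n : A) = 8 * q + 3 := by exact_mod_cast congrArg (Nat.cast (R := A)) hnq
    exact ⟨-1 - q - t, by rw [hodd.neg_one_pow, hcast]; ring⟩
  · have hnq : n = 8 * q + 5 := by omega
    have heven : Even (n * (n - 1) / 2) := by
      have : n * (n - 1) / 2 = n * (4 * q + 2) := by
        rw [show n - 1 = (4 * q + 2) * 2 by omega, ← mul_assoc, Nat.mul_div_cancel _ two_pos]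
      rw [this]
      exact Even.mul_left ⟨2 * q + 1, by ring⟩ n
    have hcast : (n : A) = 8 * q + 5 := by exact_mod_cast congrArg (Nat.cast (R := A)) hnq
    exact ⟨q + t, by rw [heven.neg_one_pow, hcast]; ring⟩

/-- Let `n ≡ ±3 (mod 8)` be odd and let `m₁ > m₂ > m₃ > 0` be odd integers with
`m₁ < n/3`.  Then the pentanomial `x^n + x^{m₁} + x^{m₂} + x^{m₃} + 1 ∈ 𝔽₂[x]` has an
even number of irreducible factors (with multiplicity); in particular it is not
irreducible. -/
theorem pentanomial_even_factors (n m₁ m₂ m₃ : ℕ) (hodd : Odd n) (hpos : 0 < n)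
    (hn8 : n % 8 = 3 ∨ n % 8 = 5)
    (h1 : Odd m₁) (h2 : Odd m₂) (h3 : Odd m₃)
    (h12 : m₂ < m₁) (h23 : m₃ < m₂) (h3pos : 0 < m₃) (hm1 : 3 * m₁ < n)
    (f : Polynomial (ZMod 2))
    (hf : f = X ^ n + X ^ m₁ + X ^ m₂ + X ^ m₃ + 1) :
    Even (UniqueFactorizationMonoid.factors f).card ∧ ¬ Irreducible f := by
  obtain ⟨F, hF⟩ : ∃ F : ℤ[X], F = X ^ n + X ^ m₁ + X ^ m₂ + X ^ m₃ + 1 := ⟨_, rfl⟩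
  have hmap (A : Type) [CommRing A] : F.map (Int.castRingHom A) =
      X ^ n + X ^ m₁ + X ^ m₂ + X ^ m₃ + 1 := by
    simp [hF]
  have hlow : (X ^ m₁ + X ^ m₂ + X ^ m₃ + 1 : ℤ[X]).degree < n := by
    have hX (k : ℕ) (hk : k < n) : (X ^ k : ℤ[X]).degree < n := by
      rw [degree_X_pow]
      exact_mod_cast hk
    have hone : (1 : ℤ[X]).degree < n := by simpa using hX 0 hpos
    simp only [← mem_degreeLT] at hX hone ⊢
    exact add_mem (add_mem (add_mem (hX m₁ (by omega)) (hX m₂ (by omega))) (hX m₃ (by omega))) hone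
  have hF' : F = X ^ n + (X ^ m₁ + X ^ m₂ + X ^ m₃ + 1) := by rw [hF]; ring
  have hmonic : F.Monic := hF' ▸ monic_X_pow_add hlow
  have hdeg : F.natDegree = n := by
    apply natDegree_eq_of_degree_eq_some
    rw [hF', degree_add_eq_left_of_degree_lt (by rwa [degree_X_pow]), degree_X_pow]
  have key := odd_natDegree_add_card_factors hmonic
    (by rw [hmap]; exact separable_pentanomial hodd h1 h2 h3)
    (by
      intro A _ x hx
      rw [hmap] at hx
      subst hdeg
      exact exists_det_vandermonde_sq_eq_s3 hn8 h1 h2 h3 h12 h23 h3pos hm1 x hx)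
  rw [hmap, ← hf, hdeg] at key
  have heven : Even (UniqueFactorizationMonoid.factors f).card :=
    (Nat.odd_add.1 key).1 hodd
  refine ⟨heven, fun hirr => ?_⟩
  rw [UniqueFactorizationMonoid.card_factors_of_irreducible hirr] at heven
  simp at heven
end

section
/- Let D be an n × n matrix with entries in Z/8Z such that for all i ≠ j the entry D_{ij} is even (i.e., divisible by 2 in Z/8Z) and D_{ij}·D_{ji} = 0 in Z/8Z. Then det(D) = ∏_{i=1}^n D_{ii}. -/
/-- If off-diagonal entries are even, opposite off-diagonal entries annihilate each other and
`8 = 0`, then every nontrivial permutation contributes zero to the Leibniz expansion. -/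
theorem Matrix.prod_perm_eq_zero_of_offdiag_even {R ι : Type*} [CommRing R] [Fintype ι]
    [DecidableEq ι] (h8 : (8 : R) = 0) (D : Matrix ι ι R)
    (h : ∀ i j, i ≠ j → (∃ c, D i j = 2 * c) ∧ D i j * D j i = 0)
    {σ : Equiv.Perm ι} (hσ : σ ≠ 1) : ∏ i, D (σ i) i = 0 := by
  obtain ⟨i, hi⟩ : ∃ i, σ i ≠ i := by
    by_contra! hfix
    exact hσ (Equiv.ext hfix)
  have hj : σ (σ i) ≠ σ i := fun e => hi (σ.injective e)
  have hk : σ (σ (σ i)) ≠ σ (σ i) := fun e => hj (σ.injective e)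
  by_cases hc : σ (σ i) = i
  · have hd := Finset.prod_dvd_prod_of_subset {i, σ i} Finset.univ (fun x => D (σ x) x)
      (Finset.subset_univ _)
    rwa [Finset.prod_pair hi.symm, hc, (h _ _ hi).2, zero_dvd_iff] at hd
  · have hd := Finset.prod_dvd_prod_of_subset {i, σ i, σ (σ i)} Finset.univ
      (fun x => D (σ x) x) (Finset.subset_univ _)
    obtain ⟨a, ha⟩ := (h _ _ hi).1
    obtain ⟨b, hb⟩ := (h _ _ hj).1
    obtain ⟨c, hc'⟩ := (h _ _ hk).1
    have hi_not_mem : i ∉ ({σ i, σ (σ i)} : Finset ι) := by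
      simp [hi.symm, Ne.symm hc]
    rw [Finset.prod_insert hi_not_mem, Finset.prod_pair hj.symm, ha, hb, hc'] at hd
    have hz : 2 * a * (2 * b * (2 * c)) = 0 := by
      linear_combination (a * b * c) * h8
    rwa [hz, zero_dvd_iff] at hd


/-- **Lemma 1 (Dlemma).** Let `D` be a square matrix over `ℤ/8ℤ` such that for `i ≠ j`
the entry `D i j` is even (an image of an even integer, i.e. a multiple of `2`) and
`D i j * D j i = 0`.  Then `det D = ∏ i, D i i`. -/
theorem det_eq_prod_diag_of_offdiag_even (n : ℕ) (D : Matrix (Fin n) (Fin n) (ZMod 8))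
    (h : ∀ i j : Fin n, i ≠ j → (∃ c : ZMod 8, D i j = 2 * c) ∧ D i j * D j i = 0) :
    D.det = ∏ i, D i i := by
  rw [Matrix.det_apply', Finset.sum_eq_single 1]
  · simp
  · intro σ _ hσ
    rw [Matrix.prod_perm_eq_zero_of_offdiag_even (by decide) D h hσ, mul_zero]
  · simp
end

section
/- Let H ∈ Z[x] with x | H and deg(H) = s, let n > 1, and let F_0, F_1, F_2 ∈ Z[x] satisfy deg(F_k) < n − k·s for k = 0, 1, 2. Then the resultant R(x^n + 4·F_0(x) + 2·F_1(x) + F_2(x), 2·H(x) + 1) is congruent to 1 modulo 8. -/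
open Polynomial

/-- The Sylvester matrix of `f` (of formal degree `n`) and `g` (of formal degree `m`):
the first `m` rows contain the coefficients of `f` and the remaining `n` rows contain
the coefficients of `g`, as in van der Waerden.  The `(i,j)` entry for `i < m` is the
coefficient of `x^{n-(j-i)}` in `f`, and for `i ≥ m` it is the coefficient of
`x^{m-(j-(i-m))}` in `g`. -/
noncomputable def sylvesterMatrix (n m : ℕ) (f g : Polynomial ℤ) :
    Matrix (Fin (m + n)) (Fin (m + n)) ℤ :=
  Matrix.of fun i j =>
    if (i : ℕ) < m then
      (if (i : ℕ) ≤ (j : ℕ) ∧ (j : ℕ) ≤ (i : ℕ) + n then f.coeff ((i : ℕ) + n - (j : ℕ))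
       else 0)
    else
      (if (i : ℕ) - m ≤ (j : ℕ) ∧ (j : ℕ) ≤ (i : ℕ) then g.coeff ((i : ℕ) - (j : ℕ))
       else 0)

/-- The resultant `R(f, g)` of `f` (formal degree `n`) and `g` (formal degree `m`),
defined as the determinant of the Sylvester matrix. -/
noncomputable def res (n m : ℕ) (f g : Polynomial ℤ) : ℤ := (sylvesterMatrix n m f g).det

theorem res_eq_resultant_reflect (n m : ℕ) (f g : ℤ[X]) :
    res n m f g = resultant (reflect m g) (reflect n f) m n := by
  rw [res, resultant, ← Matrix.det_transpose]
  congr 1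
  ext i j
  induction j using Fin.addCases with
  | left j =>
    have hj := j.isLt
    simp only [Matrix.transpose_apply, sylvesterMatrix, sylvester, Matrix.of_apply,
      Fin.addCases_left, Fin.val_castAdd, Set.mem_Icc, hj, if_true, coeff_reflect]
    split_ifs with h
    · rw [revAt_le (by omega)]
      congr 1
      omega
    · rfl
  | right j =>
    have hj : ¬ m + (j : ℕ) < m := by omega
    simp only [Matrix.transpose_apply, sylvesterMatrix, sylvester, Matrix.of_apply,
      Fin.addCases_right, Fin.val_natAdd, Set.mem_Icc, hj, if_false, coeff_reflect,
      Nat.add_sub_cancel_left, Nat.add_comm (j : ℕ) m]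
    split_ifs with h
    · rw [revAt_le (by omega)]
      congr 1
      omega
    · rfl

/-- If two polynomials agree modulo a polynomial `g` whose formal leading coefficient is `1`,
then they have the same resultant with `g`, whatever their formal degrees. -/
theorem resultant_eq_of_eq_add_mul {R : Type*} [CommRing R] {f f' g p : R[X]} {s n n' : ℕ}
    (hg : g.natDegree ≤ s) (hgs : g.coeff s = 1) (hf : f.natDegree ≤ n)
    (hf' : f'.natDegree ≤ n') (h : f = f' + g * p) :
    resultant g f s n = resultant g f' s n' := by
  have e := resultant_add_right_deg g f s n (n' + (p.natDegree + s)) hf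
  have e' := resultant_add_right_deg g f' s n' (n + (p.natDegree + s)) hf'
  rw [hgs, one_pow, one_mul] at e e'
  rw [← e, ← e', h, resultant_add_mul_right _ _ _ _ _ (by omega) hg]
  congr 1
  omega

theorem eval_four_modEq_one {P : ℤ[X]} (h0 : P.eval 0 = 1)
    (h2 : P.map (Int.castRingHom (ZMod 2)) = 1) : P.eval 4 ≡ 1 [ZMOD 8] := by
  have h1 : (2 : ℤ) ∣ P.coeff 1 := by
    have := congrArg (fun Q => coeff Q 1) h2
    simp only [coeff_map, coeff_one, one_ne_zero, if_false, eq_intCast] at this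
    exact (ZMod.intCast_zmod_eq_zero_iff_dvd _ 2).1 this
  obtain ⟨c, hc⟩ := h1
  have e : P.eval 4 = (P.divX.divX.eval 4 * 4 + P.coeff 1) * 4 + P.coeff 0 := by
    conv_lhs => rw [← divX_mul_X_add P, ← divX_mul_X_add P.divX]
    simp
  rw [coeff_zero_eq_eval_zero, h0, hc] at e
  rw [e]
  exact (Int.modEq_iff_dvd.2 ⟨-(P.divX.divX.eval 4 * 2 + c), by ring⟩)

/-- If `g ≡ X ^ s` modulo `2`, then the resultant of `g` and `1 + 4Xd` is `1` modulo `8`. -/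
theorem resultant_one_add_four_mul_X_mul_modEq {g K : ℤ[X]} (d : ℤ[X]) {s N : ℕ}
    (hgK : g = X ^ s + 2 * K) (hgs : g.coeff s = 1) (hN : (X * d).natDegree ≤ N) :
    resultant g (1 + 4 * (X * d)) s N ≡ 1 [ZMOD 8] := by
  set P : ℤ[X] := resultant (g.map C) (1 + C X * (X * d).map C) s N with hP
  have eval_P (a : ℤ) : P.eval a = resultant g (1 + C a * (X * d)) s N := by
    rw [← coe_evalRingHom, hP, ← resultant_map_map]
    have hC : (evalRingHom a).comp C = RingHom.id ℤ := by ext; simp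
    congr 1
    · rw [Polynomial.map_map, hC, Polynomial.map_id]
    · rw [Polynomial.map_add, Polynomial.map_mul, Polynomial.map_one, Polynomial.map_map, hC,
        Polynomial.map_id, map_C, coe_evalRingHom, eval_X]
  have h := eval_four_modEq_one (P := P) ?_ ?_
  · rwa [eval_P] at h
  · rw [eval_P, C_0, zero_mul, add_zero, resultant_one_right, hgs, one_pow]
  · set φ := mapRingHom (Int.castRingHom (ZMod 2))
    have hg : (g.map C).map φ = X ^ s := by
      have h2 : (2 : (ZMod 2)[X][X]) = 0 := by
        have : (2 : ZMod 2) = 0 := rfl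
        rw [← C_ofNat, ← C_ofNat, this, C_0, C_0]
      simp [hgK, h2]
    rw [← coe_mapRingHom, hP, ← resultant_map_map, hg, resultant_X_pow_left]
    · simp
    · refine natDegree_map_le.trans ?_
      refine (natDegree_add_le _ _).trans (max_le (by simp) ?_)
      exact (natDegree_C_mul_le _ _).trans (natDegree_map_le.trans hN)

theorem X_pow_dvd_reflect {F : ℤ[X]} {n k : ℕ} (h : F = 0 ∨ F.natDegree + k ≤ n) :
    X ^ k ∣ reflect n F := by
  obtain rfl | h := h
  · simp
  refine X_pow_dvd_iff.2 fun i hi => ?_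
  rw [coeff_reflect, revAt_le (by omega)]
  exact coeff_eq_zero_of_natDegree_lt (by omega)


/-- **Lemma 2, Eq. (1).** Let `H ∈ ℤ[x]` with `x ∣ H` and `deg H = s`, let `n > 1`, and
let `F₀, F₁, F₂ ∈ ℤ[x]` with `deg Fₖ < n - k·s` for `k = 0, 1, 2`.  Then
`R(x^n + 4F₀ + 2F₁ + F₂, 2H + 1) ≡ 1 (mod 8)`. -/
theorem resultant_eq_one_mod_eight₁ (H F₀ F₁ F₂ : Polynomial ℤ) (n s : ℕ)
    (hH : Polynomial.X ∣ H) (hs : H.natDegree = s) (hn : 1 < n)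
    (h0 : F₀ = 0 ∨ (F₀.natDegree : ℤ) < (n : ℤ))
    (h1 : F₁ = 0 ∨ (F₁.natDegree : ℤ) < (n : ℤ) - s)
    (h2 : F₂ = 0 ∨ (F₂.natDegree : ℤ) < (n : ℤ) - 2 * s) :
    res n s (X ^ n + 4 * F₀ + 2 * F₁ + F₂) (2 * H + 1) ≡ 1 [ZMOD 8] := by
  obtain ⟨A, hA⟩ := X_pow_dvd_reflect (n := n) (k := 1) (h0.imp_right fun h => by omega)
  obtain ⟨B, hB⟩ := X_pow_dvd_reflect (n := n) (k := s + 1) (h1.imp_right fun h => by omega)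
  obtain ⟨D, hD⟩ := X_pow_dvd_reflect (n := n) (k := 2 * s + 1) (h2.imp_right fun h => by omega)
  set K := reflect s H with hK
  have hf : reflect n (X ^ n + 4 * F₀ + 2 * F₁ + F₂) =
      1 + 4 * (X * A) + 2 * (X ^ (s + 1) * B) + X ^ (2 * s + 1) * D := by
    simp only [← C_ofNat, reflect_add, reflect_C_mul, reflect_monomial, hA, hB, hD]
    simp
  have hg : reflect s (2 * H + 1) = X ^ s + 2 * K := by
    simp only [← C_ofNat, reflect_add, reflect_C_mul, reflect_one, hK]
    ring
  have hgs : (X ^ s + 2 * K).coeff s = 1 := by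
    simp [← hg, coeff_reflect, X_dvd_iff.1 hH]
  have hgd : (X ^ s + 2 * K).natDegree ≤ s := by
    rw [← hg]
    refine natDegree_reflect_le.trans (max_le le_rfl ?_)
    compute_degree!
    exact hs.le
  have hfd : (reflect n (X ^ n + 4 * F₀ + 2 * F₁ + F₂)).natDegree ≤ n := by
    refine natDegree_reflect_le.trans (max_le le_rfl ?_)
    have e0 : F₀.natDegree ≤ n := by
      obtain rfl | h := h0
      · simp
      · omega
    have e1 : F₁.natDegree ≤ n := by
      obtain rfl | h := h1
      · simp
      · omega
    have e2 : F₂.natDegree ≤ n := by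
      obtain rfl | h := h2
      · simp
      · omega
    compute_degree!
  set d := A - K * B + K ^ 2 * D with hd
  have hfd' : (1 + 4 * (X * d)).natDegree ≤ (X * d).natDegree :=
    (natDegree_add_le _ _).trans (max_le (by simp) (natDegree_C_mul_le 4 _))
  rw [res_eq_resultant_reflect, hg, resultant_eq_of_eq_add_mul (f' := 1 + 4 * (X * d))
      (n' := (X * d).natDegree) (p := 2 * X * B + X * D * (X ^ s - 2 * K)) hgd hgs hfd
      hfd' (by rw [hf, hd]; ring)]
  exact resultant_one_add_four_mul_X_mul_modEq d rfl hgs le_rfl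
end

section
/- Let H ∈ Z[x] with x | H and deg(H) = s, let n > 1, and let F_0, F_1 ∈ Z[x] satisfy deg(F_k) < n − k·s for k = 0, 1. Then the resultant R(x^n + 2·F_0(x) + F_1(x), 4·H(x) + 1) is congruent to 1 modulo 8. -/
open Polynomial

/-- A block matrix of the form `[[1 + 2A, B], [4C, 1 + 4D]]` whose first diagonal block has
determinant `1`, with `tr D = 0` and `tr (C * B)` even, has determinant `1` modulo `8`. -/
lemma det_fromBlocks_modEq_one {ι κ : Type*} [Fintype ι] [DecidableEq ι] [Fintype κ]
    [DecidableEq κ] (A : Matrix ι ι ℤ) (B : Matrix ι κ ℤ) (C : Matrix κ ι ℤ) (D : Matrix κ κ ℤ)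
    (hA : (1 + (2 : ℤ) • A).det = 1) (hD : D.trace = 0) (hCB : 2 ∣ (C * B).trace) :
    (Matrix.fromBlocks (1 + (2 : ℤ) • A) B ((4 : ℤ) • C) (1 + (4 : ℤ) • D)).det ≡ 1 [ZMOD 8] := by
  let _ : Invertible (1 + (2 : ℤ) • A) := Matrix.invertibleOfIsUnitDet _ (hA ▸ isUnit_one)
  set A' := ⅟(1 + (2 : ℤ) • A)
  have hinv : A' = 1 - (2 : ℤ) • (A * A') := by
    have h : (1 + (2 : ℤ) • A) * A' = 1 := mul_invOf_self _
    rw [add_mul, one_mul, Matrix.smul_mul] at h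
    exact eq_sub_of_add_eq h
  have hsplit : C * A' * B = C * B - (2 : ℤ) • (C * (A * A') * B) := by
    conv_lhs => rw [hinv]
    rw [Matrix.mul_sub, Matrix.sub_mul, Matrix.mul_one, Matrix.mul_smul, Matrix.smul_mul]
  have hschur : 1 + (4 : ℤ) • D - (4 : ℤ) • C * A' * B = 1 + (4 : ℤ) • (D - C * A' * B) := by
    simp [smul_sub, add_sub_assoc]
  rw [Matrix.det_fromBlocks₁₁, hA, one_mul, hschur, Matrix.det_one_add_smul, Matrix.trace_sub, hD,
    hsplit, Matrix.trace_sub, Matrix.trace_smul, smul_eq_mul]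
  obtain ⟨t, ht⟩ := hCB
  rw [ht, Int.modEq_comm, Int.modEq_iff_dvd]
  set u := (C * (A * A') * B).trace
  generalize eval (4 : ℤ) _ = v
  exact ⟨u - t + 2 * v, by ring⟩

/-- The coefficients of `x^n + 2F₀ + F₁` just below the leading one are even. -/
lemma two_dvd_coeff_X_pow_add {F₀ F₁ : Polynomial ℤ} {n s k : ℕ}
    (h1 : F₁ = 0 ∨ (F₁.natDegree : ℤ) < (n : ℤ) - s) (hk : k < n) (hks : n ≤ k + s) :
    2 ∣ (X ^ n + 2 * F₀ + F₁).coeff k := by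
  have hF₁ : F₁.coeff k = 0 := by
    rcases h1 with rfl | h1
    · simp
    · exact coeff_eq_zero_of_natDegree_lt (by omega)
  simp [coeff_X_pow, hk.ne, hF₁, coeff_ofNat_mul]

/-- The polynomial `x^n + 2F₀ + F₁` has coefficient `1` at `x^n`. -/
lemma coeff_X_pow_add_self {F₀ F₁ : Polynomial ℤ} {n s : ℕ}
    (h0 : F₀ = 0 ∨ (F₀.natDegree : ℤ) < (n : ℤ))
    (h1 : F₁ = 0 ∨ (F₁.natDegree : ℤ) < (n : ℤ) - s) :
    (X ^ n + 2 * F₀ + F₁).coeff n = 1 := by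
  have hF₀ : F₀.coeff n = 0 := by
    rcases h0 with rfl | h0
    · simp
    · exact coeff_eq_zero_of_natDegree_lt (by omega)
  have hF₁ : F₁.coeff n = 0 := by
    rcases h1 with rfl | h1
    · simp
    · exact coeff_eq_zero_of_natDegree_lt (by omega)
  simp [hF₀, hF₁, coeff_ofNat_mul]

/-- If `f` has leading coefficient `1` at `x^n` and its next `s` coefficients are even, while
`H` has no constant term, then `R(f, 4H + 1) ≡ 1 (mod 8)`. -/
lemma res_four_mul_add_one_modEq_one {f H : Polynomial ℤ} {n s : ℕ} (hf : f.coeff n = 1)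
    (hf2 : ∀ k < n, n ≤ k + s → 2 ∣ f.coeff k) (hH0 : H.coeff 0 = 0) :
    res n s f (4 * H + 1) ≡ 1 [ZMOD 8] := by
  set M := (sylvesterMatrix n s f (4 * H + 1)).submatrix finSumFinEquiv finSumFinEquiv with hM
  have hg : ∀ k, (4 * H + 1).coeff k = 4 * H.coeff k + if k = 0 then 1 else 0 := fun k => by
    simp [coeff_ofNat_mul, coeff_one]
  have hA : ∀ i j, (2 : ℤ) ∣ (M.toBlocks₁₁ - 1) i j := by
    intro i j
    rcases eq_or_ne i j with rfl | hij
    · simp [hM, Matrix.toBlocks₁₁, sylvesterMatrix, hf]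
    · have hij' : (i : ℕ) ≠ j := fun h => hij (Fin.ext h)
      simp only [hM, Matrix.toBlocks₁₁, sylvesterMatrix, Matrix.sub_apply, Matrix.of_apply,
        Matrix.submatrix_apply, finSumFinEquiv_apply_left, Fin.val_castAdd, i.isLt, if_true,
        Matrix.one_apply_ne hij, sub_zero]
      split_ifs with h
      · exact hf2 _ (by omega) (by omega)
      · exact dvd_zero 2
  choose A hA using hA
  have hA₁ : M.toBlocks₁₁ = 1 + (2 : ℤ) • Matrix.of A := by
    rw [← sub_eq_iff_eq_add']
    ext i j
    simp [hA]
  have hdet : M.toBlocks₁₁.det = 1 := by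
    rw [Matrix.det_of_isUpperTriangular]
    · simp [hM, Matrix.toBlocks₁₁, sylvesterMatrix, hf]
    · intro i j hij
      have hij' : ¬ (i : ℕ) ≤ j := not_le.mpr hij
      simp [hM, Matrix.toBlocks₁₁, sylvesterMatrix, -Fin.val_fin_le, hij']
  let C : Matrix (Fin n) (Fin s) ℤ := Matrix.of fun r i =>
    if (r : ℕ) ≤ i then H.coeff (s + r - i) else 0
  let D : Matrix (Fin n) (Fin n) ℤ := Matrix.of fun r c =>
    if (r : ℕ) ≤ s + c ∧ (c : ℕ) ≤ r then H.coeff (r - c) else 0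
  have hC : M.toBlocks₂₁ = (4 : ℤ) • C := by
    ext r i
    have hi : (i : ℕ) ≤ s + r := by omega
    have hne : s + (r : ℕ) - i ≠ 0 := by omega
    simp [hM, Matrix.toBlocks₂₁, sylvesterMatrix, C, hg, -Fin.val_fin_le, add_comm _ s, hi, hne]
  have hD : M.toBlocks₂₂ = 1 + (4 : ℤ) • D := by
    ext r c
    rcases eq_or_ne r c with rfl | hrc
    · simp [hM, Matrix.toBlocks₂₂, sylvesterMatrix, D, hg, hH0]
    · have hrc' : (r : ℕ) ≠ c := fun h => hrc (Fin.ext h)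
      simp only [hM, Matrix.toBlocks₂₂, sylvesterMatrix, D, hg, Matrix.of_apply,
        Matrix.submatrix_apply, finSumFinEquiv_apply_right, Fin.val_natAdd, Matrix.add_apply,
        Matrix.smul_apply, smul_eq_mul, Matrix.one_apply_ne hrc, Nat.add_sub_cancel_left,
        Nat.add_sub_add_left, add_le_add_iff_left, zero_add, Nat.not_lt.mpr (Nat.le_add_right s r),
        if_false]
      split_ifs <;> omega
  have hCB : 2 ∣ (C * M.toBlocks₁₂).trace := by
    refine Finset.dvd_sum fun r _ => ?_
    rw [Matrix.diag_apply, Matrix.mul_apply]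
    refine Finset.dvd_sum fun i _ => ?_
    by_cases hri : (r : ℕ) ≤ i
    · refine Dvd.dvd.mul_left ?_ _
      simp only [hM, Matrix.toBlocks₁₂, sylvesterMatrix, Matrix.of_apply, Matrix.submatrix_apply,
        finSumFinEquiv_apply_left, finSumFinEquiv_apply_right, Fin.val_castAdd, Fin.val_natAdd,
        i.isLt, if_true]
      split_ifs with h
      · exact hf2 _ (by omega) (by omega)
      · exact dvd_zero 2
    · simp [C, hri]
  have hDtr : D.trace = 0 := by simp [Matrix.trace, D, hH0]
  rw [res, ← Matrix.det_submatrix_equiv_self finSumFinEquiv, ← hM, ← Matrix.fromBlocks_toBlocks M,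
    hA₁, hC, hD]
  exact det_fromBlocks_modEq_one _ _ _ _ (hA₁ ▸ hdet) hDtr hCB

/-- **Lemma 2, Eq. (2).** Let `H ∈ ℤ[x]` with `x ∣ H` and `deg H = s`, let `n > 1`, and
let `F₀, F₁ ∈ ℤ[x]` with `deg Fₖ < n - k·s` for `k = 0, 1`.  Then
`R(x^n + 2F₀ + F₁, 4H + 1) ≡ 1 (mod 8)`. -/
theorem resultant_eq_one_mod_eight₂ (H F₀ F₁ : Polynomial ℤ) (n s : ℕ)
    (hH : Polynomial.X ∣ H) (hs : H.natDegree = s) (hn : 1 < n)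
    (h0 : F₀ = 0 ∨ (F₀.natDegree : ℤ) < (n : ℤ))
    (h1 : F₁ = 0 ∨ (F₁.natDegree : ℤ) < (n : ℤ) - s) :
    res n s (X ^ n + 2 * F₀ + F₁) (4 * H + 1) ≡ 1 [ZMOD 8] := by
  exact res_four_mul_add_one_modEq_one (coeff_X_pow_add_self h0 h1)
    (fun _ => two_dvd_coeff_X_pow_add h1) (X_dvd_iff.mp hH)
end

section
/- Let 0 ≤ m < n and let M be an (m+n) × (m+n) matrix with entries in Z/8Z of the block form M = [[A, B], [C', D']] where A = (a_{ij}) and C = (c_{ij}) are m × m, B = (b_{iℓ}) is m × n, D = (d_{kℓ}) is n × n, and the bottom n rows of M consist of (C 0) in the first m columns (C stacked above zero rows) and D in the last n columns, with the bottom-left n × m block having C as its top m × m part and zeros below. Assume: (1) all principal diagonal entries of M equal 1, i.e., a_{ii} = 1 and d_{kk} = 1; (2) A is upper-triangular and a_{ij} is even whenever i + j is odd; (3) C is upper-triangular, every entry of C is divisible by 4, and c_{ij} = 0 whenever i + j is odd; (4) d_{kℓ} ≡ 0 (mod 4) whenever k ≠ ℓ; (5) b_{ir} is even whenever r ≤ i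 and i + r is even. Then det(M) = 1 in Z/8Z. -/
theorem Matrix.det_eq_one_of_diag_eq_one_of_offDiag_four_mul {ι : Type*} [Fintype ι]
    [DecidableEq ι] (E : Matrix ι ι (ZMod 8)) (hdiag : ∀ k, E k k = 1)
    (hoff : ∀ k l, k ≠ l → ∃ c : ZMod 8, E k l = 4 * c) : E.det = 1 := by
  have hE : ∀ k l, ∃ c : ZMod 8, E k l = (1 : Matrix ι ι (ZMod 8)) k l + 4 * c ∧
      (k = l → c = 0) := by
    intro k l
    by_cases h : k = l
    · subst h
      exact ⟨0, by simp [hdiag]⟩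
    · obtain ⟨c, hc⟩ := hoff k l h
      exact ⟨c, by simp [hc, h]⟩
  choose N hN hN0 using hE
  have h : E = 1 + (4 : ZMod 8) • Matrix.of N := by
    ext k l
    simp [hN k l]
  have htr : (Matrix.of N).trace = 0 :=
    Finset.sum_eq_zero fun k _ => hN0 k k rfl
  have h16 : (4 : ZMod 8) ^ 2 = 0 := by decide
  rw [h, Matrix.det_one_add_smul, htr, h16]
  simp

theorem ZMod.four_mul_eq_zero_of_castHom_eq_zero (x : ZMod 8)
    (hx : ZMod.castHom (by decide : 2 ∣ 8) (ZMod 2) x = 0) : 4 * x = 0 := by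
  revert x
  decide

/-- If `A` over `ℤ/8ℤ` is upper triangular of determinant `1` and its entries of odd index sum are
even, then the entries of `A⁻¹` below the diagonal or of odd index sum are even. -/
theorem Matrix.four_mul_inv_apply_eq_zero {m : ℕ} (A : Matrix (Fin m) (Fin m) (ZMod 8))
    (hdet : A.det = 1) (hlow : ∀ i j : Fin m, (j : ℕ) < (i : ℕ) → A i j = 0)
    (heven : ∀ i j : Fin m, Odd ((i : ℕ) + (j : ℕ)) → ∃ c : ZMod 8, A i j = 2 * c)
    (i j : Fin m) (hij : (j : ℕ) < (i : ℕ) ∨ Odd ((i : ℕ) + (j : ℕ))) : 4 * A⁻¹ i j = 0 := by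
  let f := ZMod.castHom (by decide : 2 ∣ 8) (ZMod 2)
  let F := f.mapMatrix A
  have hinv : f.mapMatrix A⁻¹ = F⁻¹ := by
    symm
    apply Matrix.inv_eq_left_inv
    rw [← map_mul, Matrix.nonsing_inv_mul A (by simp [hdet]), map_one]
  have hF : IsUnit F.det := by
    rw [← RingHom.map_det, hdet, map_one]
    exact isUnit_one
  let : Invertible F := F.invertibleOfIsUnitDet hF
  have h2 : ∀ i j : Fin m, Odd ((i : ℕ) + (j : ℕ)) → F i j = 0 := by
    intro i j h
    obtain ⟨c, hc⟩ := heven i j h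
    have h20 : f 2 = 0 := by decide
    simp [F, hc, map_mul, h20]
  have hlowF : F.BlockTriangular id := fun i j h => by
    simp [F, hlow i j h]
  have hpar : F.BlockTriangular (fun i : Fin m => (i : ℕ) % 2) := fun i j h => by
    apply h2
    rw [Nat.odd_iff]
    simp only at h
    omega
  have hpar' : F.BlockTriangular (fun i : Fin m => 1 - (i : ℕ) % 2) := fun i j h => by
    apply h2
    rw [Nat.odd_iff]
    simp only at h
    omega
  apply ZMod.four_mul_eq_zero_of_castHom_eq_zero
  change f.mapMatrix A⁻¹ i j = 0
  rw [hinv]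
  rcases hij with h | h
  · exact Matrix.blockTriangular_inv_of_blockTriangular hlowF h
  · rw [Nat.odd_iff] at h
    rcases Nat.lt_or_ge ((j : ℕ) % 2) ((i : ℕ) % 2) with h' | h'
    · exact Matrix.blockTriangular_inv_of_blockTriangular hpar h'
    · refine Matrix.blockTriangular_inv_of_blockTriangular hpar' (?_ : 1 - _ < 1 - _)
      omega


/-- **Lemma 3 (lemma2).** Let `0 ≤ m < n` and let `M` be the `(m+n) × (m+n)` matrix over
`ℤ/8ℤ` with block form `[[A, B], [C', D]]`, where `A, C` are `m × m`, `B` is `m × n`,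
`D` is `n × n`, and `C'` is the `n × m` matrix consisting of `C` on top of `n - m` rows
of zeros.  Assume: (1) `A` and `D` have all diagonal entries `1`; (2) `A` is
upper-triangular and `A i j` is even when `i + j` is odd; (3) `C` is upper-triangular,
all entries of `C` are divisible by `4`, and `C i j = 0` when `i + j` is odd;
(4) `D k ℓ ≡ 0 (mod 4)` for `k ≠ ℓ`; (5) `B i r` is even when `r ≤ i` and `i + r` is
even.  Then `det M = 1`. -/
theorem det_block_matrix_eq_one (m n : ℕ) (hmn : m < n)
    (A : Matrix (Fin m) (Fin m) (ZMod 8)) (B : Matrix (Fin m) (Fin n) (ZMod 8))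
    (C : Matrix (Fin m) (Fin m) (ZMod 8)) (D : Matrix (Fin n) (Fin n) (ZMod 8))
    (C' : Matrix (Fin n) (Fin m) (ZMod 8))
    (hC' : ∀ (k : Fin n) (j : Fin m),
      C' k j = if h : (k : ℕ) < m then C ⟨(k : ℕ), h⟩ j else 0)
    (h1a : ∀ i, A i i = 1) (h1d : ∀ k, D k k = 1)
    (h2a : ∀ i j : Fin m, (j : ℕ) < (i : ℕ) → A i j = 0)
    (h2b : ∀ i j : Fin m, Odd ((i : ℕ) + (j : ℕ)) → ∃ c : ZMod 8, A i j = 2 * c)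
    (h3a : ∀ i j : Fin m, (j : ℕ) < (i : ℕ) → C i j = 0)
    (h3b : ∀ i j : Fin m, ∃ c : ZMod 8, C i j = 4 * c)
    (h3c : ∀ i j : Fin m, Odd ((i : ℕ) + (j : ℕ)) → C i j = 0)
    (h4 : ∀ k l : Fin n, k ≠ l → ∃ c : ZMod 8, D k l = 4 * c)
    (h5 : ∀ (i : Fin m) (r : Fin n), (r : ℕ) ≤ (i : ℕ) → Even ((i : ℕ) + (r : ℕ)) →
      ∃ c : ZMod 8, B i r = 2 * c) :
    (Matrix.fromBlocks A B C' D).det = 1 := by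
  have hdet : A.det = 1 := by
    rw [Matrix.det_of_isUpperTriangular (fun i j h => h2a i j h)]
    simp [h1a]
  let : Invertible A := A.invertibleOfIsUnitDet (by simp [hdet])
  have hinv := Matrix.four_mul_inv_apply_eq_zero A hdet h2a h2b
  have hC4 : ∀ k j, ∃ c : ZMod 8, C' k j = 4 * c := by
    intro k j
    rw [hC']
    split_ifs with h
    · exact h3b _ _
    · exact ⟨0, by simp⟩
  have hC0 : ∀ (k : Fin n) (j : Fin m), (j : ℕ) < k ∨ Odd ((k : ℕ) + j) → C' k j = 0 := by
    intro k j hkj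
    rw [hC']
    split_ifs with h
    · exact hkj.elim (h3a ⟨k, h⟩ j) (h3c ⟨k, h⟩ j)
    · rfl
  rw [Matrix.det_fromBlocks₁₁, hdet, one_mul, Matrix.invOf_eq_nonsing_inv]
  apply Matrix.det_eq_one_of_diag_eq_one_of_offDiag_four_mul
  · intro k
    rw [Matrix.sub_apply, h1d, sub_eq_self, Matrix.mul_apply]
    refine Finset.sum_eq_zero fun i _ => ?_
    rw [Matrix.mul_apply, Finset.sum_mul]
    refine Finset.sum_eq_zero fun j _ => ?_
    by_cases hkj : (j : ℕ) < k ∨ Odd ((k : ℕ) + j)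
    · rw [hC0 k j hkj, zero_mul, zero_mul]
    obtain ⟨c, hc⟩ := hC4 k j
    rw [hc]
    by_cases hji : (i : ℕ) < j ∨ Odd ((j : ℕ) + i)
    · linear_combination c * B i k * hinv j i hji
    rw [Nat.odd_iff] at hkj hji
    obtain ⟨b, hb⟩ := h5 i k (by omega) (by rw [Nat.even_iff]; omega)
    have h8 : (8 : ZMod 8) = 0 := by decide
    rw [hb]
    linear_combination c * A⁻¹ j i * b * h8
  · intro k l hkl
    obtain ⟨d, hd⟩ := h4 k l hkl
    choose c hc using hC4 k
    refine ⟨d - ∑ i, (∑ j, c j * A⁻¹ j i) * B i l, ?_⟩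
    simp only [Matrix.sub_apply, hd, Matrix.mul_apply, hc, mul_sub, Finset.mul_sum, mul_assoc,
      Finset.sum_mul]
end

section
/- Let n ≥ 5 be odd, m = n − 4, s = ⌊(n−1)/3⌋, and let M = (X; Y) be an (m+n) × (m+n) matrix over Z/8Z, where X consists of the top m rows and Y of the bottom n rows. Assume: (H1) M_{ii} = 1 for 1 ≤ i ≤ m+n, i.e., X_{ii} = 1 for 1 ≤ i ≤ m and Y_{r, r+m} = 1 for 1 ≤ r ≤ n; (H2) X_{ij} = 0 unless j − i lies in ([0, n−s) ∩ 4Z) ∪ ([n−s, n) ∩ 2Z) ∪ {n}; (H3) Y_{ij} = 0 if j < i, and Y_{ij} is even if j ≠ m + i; (H4) for k ∈ [0, m−s), Y_{i, i+k} ≡ 0 (mod 4) if k ≡ 0 (mod 4), and Y_{i, i+k} ≡ 0 (mod 8) otherwise; (H5) for k ∈ [m−s, m+n−2s) with k ≠ m, Y_{i, i+k} ≡ 0 (mod 2) if k ≡ 2 (mod 4), Y_{i, i+k} ≡ 0 (mod 4) if k ≡ 0 (mod 4) or if k is odd and i + k > m, and Y_{i, i+k} ≡ 0 (mod 8) otherwise.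 Then det(M) = 1 in Z/8Z. -/
/-- If the members below `b` of a finite family of nonnegative integers are divisible by `q`,
then the sum of the family is divisible by `q` as soon as it is below `b`. -/
theorem Finset.dvd_sum_of_sum_lt {ι : Type*} (t : Finset ι) (d : ι → ℤ) (q b : ℤ)
    (h0 : ∀ i ∈ t, 0 ≤ d i) (hq : ∀ i ∈ t, d i < b → q ∣ d i) (hb : ∑ i ∈ t, d i < b) :
    q ∣ ∑ i ∈ t, d i :=
  Finset.dvd_sum fun i hi ↦ hq i hi ((Finset.single_le_sum h0 hi).trans_lt hb)

/-- Three or more even factors in `ℤ/8ℤ` multiply to zero. -/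
theorem ZMod.prod_eq_zero_of_three_le_card_of_even {ι : Type*} (t : Finset ι) (f : ι → ZMod 8)
    (hf : ∀ i ∈ t, ∃ a, f i = 2 * a) (ht : 3 ≤ t.card) : ∏ i ∈ t, f i = 0 := by
  choose! a ha using hf
  obtain ⟨k, hk⟩ := Nat.exists_eq_add_of_le ht
  rw [Finset.prod_congr rfl ha, Finset.prod_mul_distrib, Finset.prod_const, hk, pow_add,
    show (2 : ZMod 8) ^ 3 = 0 by decide, zero_mul, zero_mul]

theorem ZMod.four_mul_mul_two_mul (a b : ZMod 8) : 4 * a * (2 * b) = 0 := by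
  rw [show 4 * a * (2 * b) = 8 * (a * b) by ring, show (8 : ZMod 8) = 0 by decide, zero_mul]

/-- **Lemma 4 (general lemma).** Let `n ≥ 5` be odd, `m = n - 4`, `s = ⌊(n-1)/3⌋`, and
let `M` be an `(m+n) × (m+n)` matrix over `ℤ/8ℤ` whose top `m` rows form `X` and whose
bottom `n` rows form `Y` (so `X i j = M i j` for `i < m` and `Y r j = M (m + r) j`).
Assume (indices in the hypotheses below are 0-indexed; parities and differences of
indices agree with the 1-indexed formulation):
(H1) all diagonal entries of `M` are `1`;
(H2) `X i j = 0` unless `j - i ∈ ([0, n-s) ∩ 4ℤ) ∪ ([n-s, n) ∩ 2ℤ) ∪ {n}`;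
(H3) `Y r c = 0` if the column `c` is to the left of the `Y`-row index, and `Y r c` is
even off the main diagonal of `M`;
(H4) for `k ∈ [0, m-s)`, the entry `Y` at offset `k` from its row index is `≡ 0 (mod 4)`
if `4 ∣ k` and `≡ 0 (mod 8)` otherwise;
(H5) for `k ∈ [m-s, m+n-2s)`, `k ≠ m`, the entry `Y` at offset `k` is `≡ 0 (mod 2)` if
`k ≡ 2 (mod 4)`, `≡ 0 (mod 4)` if `4 ∣ k` or (`k` odd and the column lies in the last
`n` columns), and `≡ 0 (mod 8)` otherwise.
Then `det M = 1`. -/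
theorem det_eq_one_general (n m s : ℕ) (hodd : Odd n) (h5 : 5 ≤ n)
    (hm : m = n - 4) (hs : s = (n - 1) / 3)
    (M : Matrix (Fin (m + n)) (Fin (m + n)) (ZMod 8))
    (H1 : ∀ i, M i i = 1)
    (H2 : ∀ i j : Fin (m + n), (i : ℕ) < m → M i j ≠ 0 →
      (0 ≤ (j : ℤ) - (i : ℤ) ∧ (j : ℤ) - (i : ℤ) < (n : ℤ) - (s : ℤ) ∧
        (4 : ℤ) ∣ ((j : ℤ) - (i : ℤ))) ∨
      ((n : ℤ) - (s : ℤ) ≤ (j : ℤ) - (i : ℤ) ∧ (j : ℤ) - (i : ℤ) < (n : ℤ) ∧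
        (2 : ℤ) ∣ ((j : ℤ) - (i : ℤ))) ∨
      ((j : ℤ) - (i : ℤ) = (n : ℤ)))
    (H3 : ∀ r c : Fin (m + n), m ≤ (r : ℕ) →
      ((c : ℕ) < (r : ℕ) - m → M r c = 0) ∧
      ((c : ℕ) ≠ (r : ℕ) → ∃ a : ZMod 8, M r c = 2 * a))
    (H4 : ∀ r c : Fin (m + n), m ≤ (r : ℕ) → ∀ k : ℕ,
      (k : ℤ) < (m : ℤ) - (s : ℤ) → (c : ℕ) = (r : ℕ) - m + k →
      (if k % 4 = 0 then ∃ a : ZMod 8, M r c = 4 * a else M r c = 0))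
    (H5 : ∀ r c : Fin (m + n), m ≤ (r : ℕ) → ∀ k : ℕ,
      (m : ℤ) - (s : ℤ) ≤ (k : ℤ) → (k : ℤ) < (m : ℤ) + (n : ℤ) - 2 * (s : ℤ) →
      k ≠ m → (c : ℕ) = (r : ℕ) - m + k →
      (if k % 4 = 2 then ∃ a : ZMod 8, M r c = 2 * a
       else if k % 4 = 0 then ∃ a : ZMod 8, M r c = 4 * a
       else if m ≤ (c : ℕ) then ∃ a : ZMod 8, M r c = 4 * a
       else M r c = 0)) :
    M.det = 1 := by
  have hsn : 3 * s + 1 ≤ n := by omega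
  rw [← Matrix.det_transpose, Matrix.det_apply, Finset.sum_eq_single 1 ?_ (by simp)]
  · simp [H1]
  intro σ _ hσ
  simp only [Matrix.transpose_apply]
  suffices h : ∏ i, M i (σ i) = 0 by rw [h, smul_zero]
  by_contra hne
  have hM : ∀ i, M i (σ i) ≠ 0 := fun i h ↦ hne (Finset.prod_eq_zero (Finset.mem_univ i) h)
  set B : Finset (Fin (m + n)) := {i | m ≤ (i : ℕ) ∧ σ i ≠ i} with hB
  have memB : ∀ i, i ∈ B ↔ m ≤ (i : ℕ) ∧ σ i ≠ i := fun i ↦ by simp [hB]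
  have hBprod : ∏ i ∈ B, M i (σ i) ≠ 0 := fun h ↦ hne <| by
    rw [← Finset.prod_mul_prod_compl B, h, zero_mul]
  have even_of_mem : ∀ i ∈ B, ∃ a, M i (σ i) = 2 * a := fun i hi ↦ by
    rw [memB] at hi
    exact (H3 i _ hi.1).2 fun h ↦ hi.2 (Fin.ext h)
  have hcard : B.card < 3 := by
    by_contra! h
    exact hBprod (ZMod.prod_eq_zero_of_three_le_card_of_even B _ even_of_mem h)
  set d : Fin (m + n) → ℤ := fun i ↦ ((σ i : ℕ) : ℤ) - ((i : ℕ) : ℤ) with hd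
  have hsum : ∑ i ∈ B, d i + ∑ i ∈ Bᶜ, d i = 0 := by
    rw [Finset.sum_add_sum_compl, hd, Finset.sum_sub_distrib,
      Equiv.sum_comp σ fun i ↦ ((i : ℕ) : ℤ), sub_self]
  have compl : ∀ i ∈ Bᶜ, 0 ≤ d i ∧ (d i < (n : ℤ) - s → 4 ∣ d i) ∧ (d i < n → 2 ∣ d i) := by
    intro i hi
    rw [Finset.mem_compl, memB] at hi
    by_cases him : (i : ℕ) < m
    · have := H2 i (σ i) him (hM i)
      simp only [hd]
      omega
    · have : σ i = i := by
        by_contra h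
        exact hi ⟨by omega, h⟩
      simp [hd, this]
  have hT0 : 0 ≤ ∑ i ∈ Bᶜ, d i := Finset.sum_nonneg fun i hi ↦ (compl i hi).1
  have hT4 := Finset.dvd_sum_of_sum_lt Bᶜ d 4 ((n : ℤ) - s) (fun i hi ↦ (compl i hi).1)
    (fun i hi ↦ (compl i hi).2.1)
  have hT2 := Finset.dvd_sum_of_sum_lt Bᶜ d 2 n (fun i hi ↦ (compl i hi).1)
    (fun i hi ↦ (compl i hi).2.2)
  have offset : ∀ r ∈ B, ∃ k : ℕ, (σ r : ℕ) = (r : ℕ) - m + k ∧ d r = (k : ℤ) - m ∧ k ≠ m := by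
    intro r hr
    rw [memB] at hr
    have h1 : ¬ (σ r : ℕ) < (r : ℕ) - m := fun h ↦ hM r ((H3 r (σ r) hr.1).1 h)
    have h2 : (σ r : ℕ) ≠ r := fun h ↦ hr.2 (Fin.ext h)
    refine ⟨σ r - (r - m), by omega, ?_, by omega⟩
    simp only [hd]
    omega
  obtain hc | hc | hc : B.card = 0 ∨ B.card = 1 ∨ B.card = 2 := by omega
  · rw [Finset.card_eq_zero] at hc
    rw [hc, Finset.sum_empty, zero_add, ← hc,
      Finset.sum_eq_zero_iff_of_nonneg fun i hi ↦ (compl i hi).1] at hsum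
    refine hσ (Equiv.ext fun i ↦ Fin.ext ?_)
    have := hsum i (by simp [hc])
    simp only [hd] at this
    rw [Equiv.Perm.one_apply]
    omega
  · obtain ⟨r, hr⟩ := Finset.card_eq_one.mp hc
    have hrB : r ∈ B := by simp [hr]
    obtain ⟨k, hk, hdk, hkm⟩ := offset r hrB
    have hrm := ((memB r).mp hrB).1
    have hcol : (σ r : ℕ) < m := by
      by_contra! h
      have hσr := ((memB r).mp hrB).2
      have : σ r ∈ B := (memB _).mpr ⟨h, fun e ↦ hσr (σ.injective e)⟩
      rw [hr, Finset.mem_singleton] at this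
      exact hσr this
    rw [show ∑ i ∈ B, d i = d r by rw [hr, Finset.sum_singleton]] at hsum
    have hpar := hT2 (by omega)
    have hkodd : k % 2 = 1 := by
      obtain ⟨t, ht⟩ := hodd
      omega
    by_cases hks : (k : ℤ) < (m : ℤ) - s
    · have := H4 r (σ r) hrm k hks hk
      rw [if_neg (by omega)] at this
      exact hM r this
    · have := H5 r (σ r) hrm k (by omega) (by omega) hkm hk
      rw [if_neg (by omega), if_neg (by omega), if_neg (by omega)] at this
      exact hM r this
  · obtain ⟨r₁, r₂, hr, hB2⟩ := Finset.card_eq_two.mp hc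
    rw [hB2, Finset.prod_pair hr] at hBprod
    have hr₁ : r₁ ∈ B := by simp [hB2]
    have hr₂ : r₂ ∈ B := by simp [hB2]
    have not_four : ∀ r ∈ B, ¬ ∃ a, M r (σ r) = 4 * a := by
      rintro r hrB ⟨a, ha⟩
      rw [hB2, Finset.mem_insert, Finset.mem_singleton] at hrB
      obtain ⟨a₁, ha₁⟩ := even_of_mem r₁ hr₁
      obtain ⟨a₂, ha₂⟩ := even_of_mem r₂ hr₂
      obtain rfl | rfl := hrB
      · exact hBprod (by rw [ha, ha₂, ZMod.four_mul_mul_two_mul])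
      · exact hBprod (by rw [mul_comm, ha, ha₁, ZMod.four_mul_mul_two_mul])
    have constraint : ∀ r ∈ B, ∀ k : ℕ, (σ r : ℕ) = (r : ℕ) - m + k → k ≠ m →
        (m : ℤ) - s ≤ k ∧ ((k : ℤ) < (m : ℤ) + n - 2 * s → k % 4 = 2) := by
      intro r hrB k hk hkm
      have hrm := ((memB r).mp hrB).1
      have hks : (m : ℤ) - s ≤ k := by
        by_contra! h
        have := H4 r (σ r) hrm k h hk
        split_ifs at this
        · exact not_four r hrB this
        · exact hM r this
      refine ⟨hks, fun h ↦ ?_⟩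
      by_contra h2
      have := H5 r (σ r) hrm k hks h hkm hk
      rw [if_neg h2] at this
      split_ifs at this
      · exact not_four r hrB this
      · exact not_four r hrB this
      · exact hM r this
    obtain ⟨k₁, hk₁, hd₁, hm₁⟩ := offset r₁ hr₁
    obtain ⟨k₂, hk₂, hd₂, hm₂⟩ := offset r₂ hr₂
    obtain ⟨hl₁, hu₁⟩ := constraint r₁ hr₁ k₁ hk₁ hm₁
    obtain ⟨hl₂, hu₂⟩ := constraint r₂ hr₂ k₂ hk₂ hm₂
    rw [show ∑ i ∈ B, d i = d r₁ + d r₂ by rw [hB2, Finset.sum_pair hr]] at hsum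
    have h4 := hT4 (by omega)
    have h₁ := hu₁ (by omega)
    have h₂ := hu₂ (by omega)
    obtain ⟨t, ht⟩ := hodd
    omega
end
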